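/- arXiv:2306.07110 — 9 statements merged into one kernel-verified Lean document; each statement's English description precedes it below -/
import Mathlib

section
/- Let X be a Hausdorff, locally compact, second-countable, totally disconnected topological space. Then X is strictly paracompact: for every family (U_i)_{i∈I} of open subsets of X with X = ⋃_{i∈I} U_i, there exists a family (V_j)_{j∈J} of open subsets of X that are pairwise disjoint, whose union is X, and such that every V_j is contained in U_i for some i ∈ I. -/
/-- A Hausdorff, locally compact, second-countable, totally disconnected topological space
is strictly paracompact: every open cover admits a refinement by pairwise disjoint open sets
covering the space. -/
theorem strictly_paracompact_of_t2_locallyCompact_secondCountable_totallyDisconnected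
    {X : Type*} [TopologicalSpace X] [T2Space X] [LocallyCompactSpace X]
    [SecondCountableTopology X] [TotallyDisconnectedSpace X]
    {I : Type*} (U : I → Set X) (hUopen : ∀ i, IsOpen (U i))
    (hUcover : ⋃ i, U i = Set.univ) :
    ∃ (J : Type) (V : J → Set X),
      (∀ j, IsOpen (V j)) ∧
      (Pairwise fun j j' => Disjoint (V j) (V j')) ∧
      (⋃ j, V j = Set.univ) ∧
      (∀ j, ∃ i, V j ⊆ U i) := by
  classical
  rcases isEmpty_or_nonempty X with hX | hX
  · exact ⟨Empty, fun _ => ∅, fun j => j.elim, fun j => j.elim,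
      Set.eq_univ_of_forall fun x => hX.elim x, fun j => j.elim⟩
  have h : ∀ x : X, ∃ W : Set X, IsClopen W ∧ x ∈ W ∧ ∃ i, W ⊆ U i := by
    intro x
    have hx : x ∈ ⋃ i, U i := hUcover ▸ Set.mem_univ x
    obtain ⟨i, hi⟩ := Set.mem_iUnion.1 hx
    obtain ⟨W, hW, hxW, hWU⟩ :=
      (loc_compact_Haus_tot_disc_of_zero_dim (H := X)).mem_nhds_iff.1 ((hUopen i).mem_nhds hi)
    exact ⟨W, hW, hxW, i, hWU⟩
  choose W hW hxW hWU using h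
  obtain ⟨s, hs, hsU⟩ :=
    TopologicalSpace.countable_cover_nhds fun x => (hW x).isOpen.mem_nhds (hxW x)
  have hne : s.Nonempty := by
    obtain ⟨x⟩ := hX
    have hx : x ∈ ⋃ y ∈ s, W y := hsU ▸ Set.mem_univ x
    obtain ⟨y, hy, -⟩ := Set.mem_iUnion₂.1 hx
    exact ⟨y, hy⟩
  obtain ⟨f, rfl⟩ := hs.exists_eq_range hne
  refine ⟨ℕ, disjointed fun n => W (f n), fun n => ?_, disjoint_disjointed _, ?_, fun n => ?_⟩
  · refine IsClopen.isOpen ?_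
    exact disjointedRec (p := IsClopen) (fun t i ht => ht.diff (hW _)) (hW (f n))
  · rw [iUnion_disjointed]
    simpa using hsU
  · obtain ⟨i, hi⟩ := hWU (f n)
    exact ⟨i, (disjointed_subset _ n).trans hi⟩
end

section
/- Let p be a prime and n ≥ 5. Then every quadratic form Q on ℚ_p^n is isotropic: there exists x ∈ ℚ_p^n with x ≠ 0 and Q(x) = 0. Equivalently, no quadratic form on ℚ_p^n is definite for n ≥ 5. -/
open Padic

namespace PadicFive

/-- The diagonal form with weights `w` has a nontrivial zero. -/
def Iso {K ι : Type} [Field K] [Fintype ι] (w : ι → K) : Prop :=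
  ∃ x : ι → K, x ≠ 0 ∧ ∑ i, w i * x i ^ 2 = 0

lemma Iso.comp {K ι κ : Type} [Field K] [Fintype ι] [Fintype κ] {w : ι → K} (e : κ → ι)
    (he : Function.Injective e) (h : Iso (fun i => w (e i))) : Iso w := by
  obtain ⟨y, hy, hs⟩ := h
  refine ⟨Function.extend e y 0, ?_, ?_⟩
  · intro h0
    apply hy
    ext i
    have := congrFun h0 (e i)
    rwa [he.extend_apply] at this
  · rw [← hs]
    symm
    apply Fintype.sum_of_injective e he
    · intro i hi
      rw [Function.extend_apply' _ _ _ (by simpa using hi)]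
      simp
    · intro i
      rw [he.extend_apply]

lemma Iso.scale {K ι : Type} [Field K] [Fintype ι] {w u s : ι → K} (t : K)
    (hs : ∀ i, s i ≠ 0) (hw : ∀ i, w i = t * s i ^ 2 * u i) (h : Iso u) : Iso w := by
  obtain ⟨y, hy, h0⟩ := h
  refine ⟨fun i => y i / s i, ?_, ?_⟩
  · intro hz
    apply hy
    ext i
    have := congrFun hz i
    simpa [hs i] using this
  · rw [← mul_zero t, ← h0, Finset.mul_sum]
    refine Finset.sum_congr rfl fun i _ => ?_
    rw [hw]
    have := hs i
    field_simp

variable {p : ℕ} [hp : Fact p.Prime]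

lemma hensel (u : ℤ_[p]ˣ) (c : ℤ_[p]) (h : ‖(u : ℤ_[p]) + c‖ < ‖(2 : ℤ_[p])‖ ^ 2) :
    ∃ z : ℤ_[p], z ≠ 0 ∧ (u : ℤ_[p]) * z ^ 2 + c = 0 := by
  let F : Polynomial ℤ_[p] := Polynomial.C (u : ℤ_[p]) * Polynomial.X ^ 2 + Polynomial.C c
  have hd : ‖(Polynomial.aeval (1 : ℤ_[p])) F.derivative‖ = ‖(2 : ℤ_[p])‖ := by
    simp [F, one_add_one_eq_two]
  have hF : ‖(Polynomial.aeval (1 : ℤ_[p])) F‖ < ‖(Polynomial.aeval (1 : ℤ_[p])) F.derivative‖ ^ 2 := by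
    rw [hd]
    simpa [F] using h
  obtain ⟨z, hz, hz1, -⟩ := hensels_lemma hF
  refine ⟨z, ?_, by simpa [F] using hz⟩
  rintro rfl
  rw [hd] at hz1
  have : ‖(2 : ℤ_[p])‖ ≤ 1 := PadicInt.norm_le_one _
  simp at hz1
  linarith

lemma iso_odd (h2 : p ≠ 2) (u : Fin 3 → ℤ_[p]ˣ) :
    Iso (fun i => ((u i : ℤ_[p]) : ℚ_[p])) := by
  have hn2 : ‖(2 : ℤ_[p])‖ = 1 := by
    have := (PadicInt.norm_natCast_eq_one_iff (p := p) (n := 2)).2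
      ((Nat.coprime_primes hp.out Nat.prime_two).2 h2)
    simpa using this
  have hu : ∀ i, PadicInt.toZMod (u i : ℤ_[p]) ≠ 0 := fun i =>
    ((u i).isUnit.map PadicInt.toZMod).ne_zero
  obtain ⟨a, b, hab⟩ := FiniteField.exists_root_sum_quadratic (R := ZMod p)
    (f := Polynomial.C (PadicInt.toZMod (u 1 : ℤ_[p])) * Polynomial.X ^ 2 + Polynomial.C 0 * Polynomial.X
      + Polynomial.C (PadicInt.toZMod (u 0 : ℤ_[p])))
    (g := Polynomial.C (PadicInt.toZMod (u 2 : ℤ_[p])) * Polynomial.X ^ 2 + Polynomial.C 0 * Polynomial.X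
      + Polynomial.C 0)
    (Polynomial.degree_quadratic (hu 1)) (Polynomial.degree_quadratic (hu 2))
    (by rw [ZMod.card]; exact (hp.out.eq_two_or_odd).resolve_left h2)
  obtain ⟨a, rfl⟩ := ZMod.ringHom_surjective (PadicInt.toZMod (p := p)) a
  obtain ⟨b, rfl⟩ := ZMod.ringHom_surjective (PadicInt.toZMod (p := p)) b
  obtain ⟨z, hz, h⟩ := hensel (u 0) ((u 1 : ℤ_[p]) * a ^ 2 + (u 2 : ℤ_[p]) * b ^ 2) (by
    rw [hn2, one_pow, ← PadicInt.mem_nonunits, ← IsLocalRing.mem_maximalIdeal,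
      ← PadicInt.ker_toZMod, RingHom.mem_ker]
    simp at hab
    simp only [map_add, map_mul, map_pow]
    linear_combination hab)
  refine ⟨![(z : ℚ_[p]), a, b], fun h0 => hz ?_, ?_⟩
  · have := congrFun h0 0
    simpa using this
  · have := congrArg (fun x : ℤ_[p] => (x : ℚ_[p])) h
    simp [Fin.sum_univ_three] at this ⊢
    linear_combination this

lemma hensel2 (u : ℤ_[2]ˣ) (c : ℤ_[2])
    (h : PadicInt.toZModPow 3 (u : ℤ_[2]) + PadicInt.toZModPow 3 c = 0) :
    ∃ z : ℤ_[2], z ≠ 0 ∧ (u : ℤ_[2]) * z ^ 2 + c = 0 := by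
  apply hensel
  rw [← map_add, ← RingHom.mem_ker, PadicInt.ker_toZModPow,
    ← PadicInt.norm_le_pow_iff_mem_span_pow] at h
  have h2 : ‖(2 : ℤ_[2])‖ = 2⁻¹ := by
    have := PadicInt.norm_p (p := 2)
    simpa using this
  rw [h2]
  refine lt_of_le_of_lt h ?_
  norm_num [zpow_neg]

lemma unit8 : ∀ a : ZMod 8, IsUnit a → a * a = 1 := by decide

lemma usq (u : ℤ_[2]ˣ) :
    (PadicInt.toZModPow 3 (u : ℤ_[2]) : ZMod 8) * (PadicInt.toZModPow 3 (u : ℤ_[2]) : ZMod 8) = 1 :=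
  unit8 _ ((u.isUnit.map (PadicInt.toZModPow 3)))

set_option maxRecDepth 100000 in
lemma dec4 : ∀ a : ZMod 8, a * a = 1 → ∀ b : ZMod 8, b * b = 1 → ∀ c : ZMod 8, c * c = 1 →
    ∀ d : ZMod 8, d * d = 1 →
    (a + b = 0 ∨ a + b + c * 4 = 0 ∨ a + b + 2 * d = 0 ∨ a + b + c * 4 + 2 * d = 0) := by
  decide

lemma dec5a : ∀ a : ZMod 8, a * a = 1 → ∀ b : ZMod 8, b * b = 1 → ∀ c : ZMod 8, c * c = 1 →
    (a + b = 0 ∨ a + b + c * 4 = 0 ∨ a + c = 0 ∨ a + c + b * 4 = 0 ∨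
    (2 * a = 2 * b ∧ 2 * a = 2 * c)) := by
  decide

lemma dec5b : ∀ a : ZMod 8, a * a = 1 → ∀ b : ZMod 8, b * b = 1 → ∀ d : ZMod 8, d * d = 1 →
    (a + d = 0 ∨ a + d + b * 4 = 0 ∨ 2 * a = 2 * d) := by
  decide

set_option maxRecDepth 100000 in
lemma dec5c : ∀ a : ZMod 8, a * a = 1 → ∀ b : ZMod 8, b * b = 1 ∧ 2 * a = 2 * b →
    ∀ c : ZMod 8, c * c = 1 ∧ 2 * a = 2 * c →
    ∀ d : ZMod 8, d * d = 1 ∧ 2 * a = 2 * d → ∀ e : ZMod 8, e * e = 1 →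
    (a + b + c + d = 0 ∨ a + b + c + d + e * 4 = 0) := by
  decide

lemma iso_two4 (u : Fin 4 → ℤ_[2]ˣ) :
    Iso ![((u 0 : ℤ_[2]) : ℚ_[2]), ((u 1 : ℤ_[2]) : ℚ_[2]), ((u 2 : ℤ_[2]) : ℚ_[2]),
      2 * ((u 3 : ℤ_[2]) : ℚ_[2])] := by
  have key : ∃ x y z : ℤ_[2], PadicInt.toZModPow 3 (u 0 : ℤ_[2]) + PadicInt.toZModPow 3
      ((u 1 : ℤ_[2]) * x ^ 2 + (u 2 : ℤ_[2]) * y ^ 2 + 2 * (u 3 : ℤ_[2]) * z ^ 2) = 0 := by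
    have h4 : (2 : ZMod 8) ^ 2 = 4 := by decide
    have ht : PadicInt.toZModPow 3 (2 : ℤ_[2]) = (2 : ZMod 8) := map_ofNat _ 2
    rcases dec4 _ (usq (u 0)) _ (usq (u 1)) _ (usq (u 2)) _ (usq (u 3)) with h | h | h | h
    · refine ⟨1, 0, 0, Eq.trans ?_ h⟩; simp
    · refine ⟨1, 2, 0, Eq.trans ?_ h⟩; rw [← h4, ← ht]; simp [add_assoc]
    · refine ⟨1, 0, 1, Eq.trans ?_ h⟩; rw [← ht]; simp [add_assoc]
    · refine ⟨1, 2, 1, Eq.trans ?_ h⟩; rw [← h4, ← ht]; simp [add_assoc]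
  obtain ⟨x, y, t, h⟩ := key
  obtain ⟨z, hz, h⟩ := hensel2 _ _ h
  refine ⟨![(z : ℚ_[2]), x, y, t], fun h0 => hz ?_, ?_⟩
  · have := congrFun h0 0
    simpa using this
  · have := congrArg (fun x : ℤ_[2] => (x : ℚ_[2])) h
    have h2 : ((2 : ℤ_[2]) : ℚ_[2]) = 2 := rfl
    simp [Fin.sum_univ_four, h2] at this ⊢
    linear_combination this

lemma iso_two5 (u : Fin 5 → ℤ_[2]ˣ) :
    Iso (fun i => ((u i : ℤ_[2]) : ℚ_[2])) := by
  have key : ∃ x y z t : ℤ_[2], PadicInt.toZModPow 3 (u 0 : ℤ_[2]) + PadicInt.toZModPow 3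
      ((u 1 : ℤ_[2]) * x ^ 2 + (u 2 : ℤ_[2]) * y ^ 2 + (u 3 : ℤ_[2]) * z ^ 2
        + (u 4 : ℤ_[2]) * t ^ 2) = 0 := by
    have h4 : (2 : ZMod 8) ^ 2 = 4 := by decide
    have ht : PadicInt.toZModPow 3 (2 : ℤ_[2]) = (2 : ZMod 8) := map_ofNat _ 2
    rcases dec5a _ (usq (u 0)) _ (usq (u 1)) _ (usq (u 2)) with h | h | h | h | ⟨hb, hc⟩
    · refine ⟨1, 0, 0, 0, Eq.trans ?_ h⟩; simp
    · refine ⟨1, 2, 0, 0, Eq.trans ?_ h⟩; rw [← h4, ← ht]; simp [add_assoc]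
    · refine ⟨0, 1, 0, 0, Eq.trans ?_ h⟩; simp
    · refine ⟨2, 1, 0, 0, Eq.trans ?_ h⟩; rw [← h4, ← ht]; simp [add_assoc, add_comm]
    rcases dec5b _ (usq (u 0)) _ (usq (u 1)) _ (usq (u 3)) with h | h | hd
    · refine ⟨0, 0, 1, 0, Eq.trans ?_ h⟩; simp
    · refine ⟨2, 0, 1, 0, Eq.trans ?_ h⟩; rw [← h4, ← ht]; simp [add_assoc, add_comm]
    rcases dec5c _ (usq (u 0)) _ ⟨usq (u 1), hb⟩ _ ⟨usq (u 2), hc⟩ _ ⟨usq (u 3), hd⟩ _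
      (usq (u 4)) with h | h
    · refine ⟨1, 1, 1, 0, Eq.trans ?_ h⟩; simp [add_assoc]
    · refine ⟨1, 1, 1, 2, Eq.trans ?_ h⟩; rw [← h4, ← ht]; simp [add_assoc]
  obtain ⟨x, y, t, s, h⟩ := key
  obtain ⟨z, hz, h⟩ := hensel2 _ _ h
  refine ⟨![(z : ℚ_[2]), x, y, t, s], fun h0 => hz ?_, ?_⟩
  · have := congrFun h0 0
    simpa using this
  · have := congrArg (fun x : ℤ_[2] => (x : ℚ_[2])) h
    simp [Fin.sum_univ_five] at this ⊢
    linear_combination this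

lemma normal_form (w : ℚ_[p]) (hw : w ≠ 0) : ∃ (u : ℤ_[p]ˣ) (s : ℚ_[p]) (b : Bool),
    s ≠ 0 ∧ w = (if b then (p : ℚ_[p]) else 1) * s ^ 2 * ((u : ℤ_[p]) : ℚ_[p]) := by
  have hp0 : (p : ℚ_[p]) ≠ 0 := by exact_mod_cast hp.out.ne_zero
  have hpR : (p : ℝ) ≠ 0 := by exact_mod_cast hp.out.ne_zero
  have hn : ‖w * (p : ℚ_[p]) ^ (-w.valuation)‖ = 1 := by
    rw [norm_mul, Padic.norm_eq_zpow_neg_valuation hw, Padic.norm_p_zpow, neg_neg,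
      ← zpow_add₀ hpR]
    simp
  rcases Int.even_or_odd' w.valuation with ⟨m, hm | hm⟩
  · refine ⟨PadicInt.mkUnits hn, (p : ℚ_[p]) ^ m, false, zpow_ne_zero _ hp0, ?_⟩
    rw [PadicInt.mkUnits_eq, zpow_neg, hm, mul_comm 2 m, zpow_mul]
    have := zpow_ne_zero m hp0
    simp [zpow_ofNat]
    field_simp
  · refine ⟨PadicInt.mkUnits hn, (p : ℚ_[p]) ^ m, true, zpow_ne_zero _ hp0, ?_⟩
    rw [PadicInt.mkUnits_eq, zpow_neg, hm, mul_comm 2 m, zpow_add₀ hp0, zpow_mul]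
    have := zpow_ne_zero m hp0
    simp [zpow_ofNat]
    field_simp

lemma pigeon : ∀ b : Fin 5 → Bool, ∃ i j k : Fin 5, (i ≠ j ∧ i ≠ k ∧ j ≠ k) ∧
    b j = b i ∧ b k = b i := by
  decide

lemma iso_five (w : Fin 5 → ℚ_[p]) : Iso w := by
  have hp0 : (p : ℚ_[p]) ≠ 0 := by exact_mod_cast hp.out.ne_zero
  by_cases h0 : ∃ i, w i = 0
  · obtain ⟨i, hi⟩ := h0
    refine ⟨Pi.single i 1, by simp, ?_⟩
    apply Finset.sum_eq_zero
    intro j _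
    by_cases hj : j = i
    · subst hj; simp [hi]
    · simp [hj]
  push Not at h0
  choose u s b hs hw using fun i => normal_form (w i) (h0 i)
  obtain ⟨i, j, k, ⟨hij, hik, hjk⟩, hj, hk⟩ := pigeon b
  by_cases h2 : p = 2
  · subst h2
    by_cases hl : ∃ l, b l ≠ b i
    · obtain ⟨l, hl⟩ := hl
      have hli : l ≠ i := fun h => hl (by rw [h])
      have hlj : l ≠ j := fun h => hl (by rw [h, hj])
      have hlk : l ≠ k := fun h => hl (by rw [h, hk])
      apply Iso.comp ![i, j, k, l]
      · intro x y hxy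
        fin_cases x <;> fin_cases y <;> simp_all
      · have h4 := iso_two4 (fun m => u (![i, j, k, l] m))
        refine Iso.scale (if b i then ((2 : ℕ) : ℚ_[2]) else 1)
          (s := ![s i, s j, s k, if b i then s l / 2 else s l]) ?_ ?_ h4
        · intro m
          fin_cases m
          · exact hs i
          · exact hs j
          · exact hs k
          · have := hs l
            cases hb : b i <;> simp [hb, this]
        · intro m
          fin_cases m
          · exact hw i
          · have := hw j
            rw [hj] at this
            exact this
          · have := hw k
            rw [hk] at this
            exact this
          · have := hw l
            cases hb : b i
            · have hbl : b l = true := by simpa [hb] using hl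
              simp [hbl] at this ⊢
              rw [this]; ring
            · have hbl : b l = false := by simpa [hb] using hl
              simp [hbl] at this ⊢
              rw [this]; ring
    · push Not at hl
      refine Iso.scale (if b i then ((2 : ℕ) : ℚ_[2]) else 1) hs ?_ (iso_two5 u)
      intro m
      rw [← hl m]
      exact hw m
  · apply Iso.comp ![i, j, k]
    · intro x y hxy
      fin_cases x <;> fin_cases y <;> simp_all
    · refine Iso.scale (if b i then (p : ℚ_[p]) else 1) (s := fun m => s (![i, j, k] m))
        (fun m => hs _) ?_ (iso_odd h2 (fun m => u (![i, j, k] m)))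
      intro m
      have hb : b (![i, j, k] m) = b i := by fin_cases m <;> simp [hj, hk]
      rw [← hb]
      exact hw _

end PadicFive

/-- Every quadratic form on `ℚ_p^n` with `n ≥ 5` is isotropic: it represents zero
nontrivially. Equivalently, no quadratic form on `ℚ_p^n` is definite for `n ≥ 5`. -/
theorem Padic.quadraticForm_isotropic_of_five_le {p : ℕ} [Fact p.Prime] {n : ℕ} (hn : 5 ≤ n)
    (Q : QuadraticForm ℚ_[p] (Fin n → ℚ_[p])) :
    ∃ x : Fin n → ℚ_[p], x ≠ 0 ∧ Q x = 0 := by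
  have : Invertible (2 : ℚ_[p]) := invertibleOfNonzero two_ne_zero
  obtain ⟨w, ⟨e⟩⟩ := QuadraticForm.equivalent_weightedSumSquares Q
  have hf : 5 ≤ Module.finrank ℚ_[p] (Fin n → ℚ_[p]) := by simpa using hn
  obtain ⟨x, hx, h⟩ := PadicFive.Iso.comp (w := w) (Fin.castLE hf) (Fin.castLE_injective hf)
    (PadicFive.iso_five _)
  refine ⟨e.symm x, ?_, ?_⟩
  · intro h0
    apply hx
    have := congrArg e h0
    simpa using this
  · rw [QuadraticMap.IsometryEquiv.map_app, QuadraticMap.weightedSumSquares_apply, ← h]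
    refine Finset.sum_congr rfl fun i _ => ?_
    rw [smul_eq_mul, sq]
end

section
/- Let p be an odd prime, let u ∈ ℚ_p be a p-adic unit (|u|_p = 1) that is not a square in ℚ_p, and set v := -u if p ≡ 1 (mod 4) and v := -1 if p ≡ 3 (mod 4). Then the quadratic form Q_+ on ℚ_p³ defined by Q_+(x) = x₀² − v·x₁² + p·x₂² is definite (anisotropic): Q_+(x) = 0 implies x = 0. -/
theorem padicAux_sq {p : ℕ} [Fact p.Prime] (hp : p ≠ 2) (t v : ℚ_[p]) (hv : ‖v‖ = 1)
    (h : ‖t ^ 2 - v‖ < 1) : IsSquare v := by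
  have ht2 : ‖t ^ 2‖ = 1 := by
    have h1 := Padic.norm_eq_of_norm_sub_lt_right (z1 := t ^ 2) (z2 := v) (by rwa [hv])
    rw [h1, hv]
  have ht : ‖t‖ = 1 := by
    rw [norm_pow] at ht2
    exact (pow_eq_one_iff_of_nonneg (norm_nonneg _) two_ne_zero).1 ht2
  obtain ⟨T, hT⟩ : ∃ T : ℤ_[p], (T : ℚ_[p]) = t := ⟨⟨t, ht.le⟩, rfl⟩
  obtain ⟨V, hV⟩ : ∃ V : ℤ_[p], (V : ℚ_[p]) = v := ⟨⟨v, hv.le⟩, rfl⟩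
  have h2 : ‖(2 : ℚ_[p])‖ = 1 := by
    have : ‖((2 : ℕ) : ℚ_[p])‖ = 1 := by
      rw [Padic.norm_natCast_eq_one_iff]
      exact (Nat.coprime_primes Fact.out Nat.prime_two).2 hp
    simpa using this
  have := hensels_lemma (F := (Polynomial.X ^ 2 - Polynomial.C V : Polynomial ℤ_[p])) (a := T) (by
    have e1 : ‖T ^ 2 - V‖ < 1 := by
      rw [PadicInt.norm_def, PadicInt.coe_sub, PadicInt.coe_pow, hT, hV]
      exact h
    have e2 : ‖(2 : ℤ_[p]) * T‖ = 1 := by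
      have c2 : ((2 : ℤ_[p]) : ℚ_[p]) = 2 := by exact_mod_cast PadicInt.coe_natCast (p := p) 2
      rw [PadicInt.norm_def, PadicInt.coe_mul, c2, hT, norm_mul, h2, ht, one_mul]
    simpa [Polynomial.derivative_pow, e2] using e1)
  obtain ⟨z, hz, -⟩ := this
  have hz' : z ^ 2 - V = 0 := by simpa using hz
  refine ⟨(z : ℚ_[p]), ?_⟩
  have := congrArg (fun w : ℤ_[p] => (w : ℚ_[p])) hz'
  simp only [PadicInt.coe_sub, PadicInt.coe_pow, hV, PadicInt.coe_zero] at this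
  linear_combination -this

theorem padicAux_parity {p : ℕ} [Fact p.Prime] (a c : ℚ_[p])
    (h : ‖a‖ ^ 2 = ‖(p : ℚ_[p]) * c ^ 2‖) : a = 0 := by
  by_contra ha
  have hpp : p.Prime := Fact.out
  have hp0 : (p : ℚ_[p]) ≠ 0 := by exact_mod_cast hpp.ne_zero
  have hc : c ≠ 0 := by
    rintro rfl
    simp at h
    exact ha h
  rw [← norm_pow, Padic.norm_eq_zpow_neg_valuation (pow_ne_zero 2 ha),
    Padic.norm_eq_zpow_neg_valuation (mul_ne_zero hp0 (pow_ne_zero 2 hc))] at h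
  have h' := zpow_right_injective₀ (a := (p : ℝ)) (by exact_mod_cast hpp.pos)
    (by exact_mod_cast hpp.one_lt.ne') h
  rw [Padic.valuation_mul hp0 (pow_ne_zero 2 hc), Padic.valuation_pow, Padic.valuation_pow,
    Padic.valuation_p] at h'
  push_cast at h'
  omega

theorem padicAux_nonsq {p : ℕ} [Fact p.Prime] (hp : p ≠ 2)
    (u : ℚ_[p]) (hu' : ¬ IsSquare u)
    (v : ℚ_[p]) (hv : v = if p % 4 = 1 then -u else -1) : ¬ IsSquare v := by
  have hpp : p.Prime := Fact.out
  rintro ⟨r, hr⟩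
  split_ifs at hv with h4
  · have h1 : IsSquare (-1 : ZMod p) := ZMod.exists_sq_eq_neg_one_iff.2 (by omega)
    obtain ⟨k, hk⟩ := h1
    have h3 : ((k.val ^ 2 + 1 : ℕ) : ZMod p) = 0 := by
      push_cast
      rw [ZMod.natCast_zmod_val]
      linear_combination -hk
    have h5 : IsSquare (-1 : ℚ_[p]) := by
      refine padicAux_sq hp (k.val : ℚ_[p]) _ (by simp) ?_
      have := (Padic.norm_natCast_lt_one_iff (p := p)).2 ((ZMod.natCast_eq_zero_iff _ _).1 h3)
      simpa using this
    obtain ⟨i, hi⟩ := h5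
    exact hu' ⟨i * r, by linear_combination hv - hr + (r * r) * hi⟩
  · have hn : ‖r‖ = 1 := by
      have : ‖r‖ ^ 2 = 1 := by rw [← norm_pow, pow_two, ← hr, hv]; simp
      exact (pow_eq_one_iff_of_nonneg (norm_nonneg _) two_ne_zero).1 this
    obtain ⟨R, hR0⟩ : ∃ R : ℤ_[p], (R : ℚ_[p]) = r := ⟨⟨r, hn.le⟩, rfl⟩
    have hR : (-1 : ℤ_[p]) = R * R := by
      apply Subtype.ext
      rw [PadicInt.coe_mul, PadicInt.coe_neg, PadicInt.coe_one, hR0, ← hr, hv]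
    have h1 : IsSquare (-1 : ZMod p) := ⟨PadicInt.toZMod R, by
      rw [← map_mul, ← hR]; simp⟩
    have := ZMod.exists_sq_eq_neg_one_iff.1 h1
    have := hpp.eq_two_or_odd
    omega

/-- For an odd prime `p`, with `u` a non-square `p`-adic unit and
`v = -u` if `p ≡ 1 (mod 4)`, `v = -1` if `p ≡ 3 (mod 4)`, the ternary quadratic form
`Q₊(x) = x₀² − v·x₁² + p·x₂²` on `ℚ_p³` is definite (anisotropic). -/
theorem Padic.quadraticForm_dim3_anisotropic {p : ℕ} [Fact p.Prime] (hp : p ≠ 2)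
    (u : ℚ_[p]) (hu : ‖u‖ = 1) (hu' : ¬ IsSquare u)
    (v : ℚ_[p]) (hv : v = if p % 4 = 1 then -u else -1) :
    ∀ x : Fin 3 → ℚ_[p],
      x 0 ^ 2 - v * x 1 ^ 2 + (p : ℚ_[p]) * x 2 ^ 2 = 0 → x = 0 := by
  intro x hx
  have hns := padicAux_nonsq hp u hu' v hv
  have hv1 : ‖v‖ = 1 := by
    rw [hv]; split_ifs <;> simp [hu]
  have hpp : p.Prime := Fact.out
  have hp0 : (p : ℚ_[p]) ≠ 0 := by exact_mod_cast hpp.ne_zero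
  by_cases hb : x 1 = 0
  · have h0 : x 0 = 0 := by
      apply padicAux_parity (x 0) (x 2)
      rw [← norm_pow, ← norm_neg (x 0 ^ 2)]
      congr 1
      rw [hb] at hx
      linear_combination -hx
    have h2 : x 2 = 0 := by
      simpa [hb, h0, hp0] using hx
    funext i
    fin_cases i <;> simp [h0, hb, h2]
  · exfalso
    have key : v - (x 0 / x 1) ^ 2 = (p : ℚ_[p]) * (x 2 / x 1) ^ 2 := by
      field_simp
      linear_combination -hx
    have key2 : ‖(x 0 / x 1) ^ 2 - v‖ = ‖(p : ℚ_[p]) * (x 2 / x 1) ^ 2‖ := by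
      rw [← key, norm_sub_rev]
    set t := x 0 / x 1
    rcases le_or_gt ‖t‖ 1 with ht | ht
    · have h1 : ‖t ^ 2 - v‖ = 1 := by
        apply le_antisymm
        · rw [sub_eq_add_neg]
          refine (Padic.nonarchimedean _ _).trans (max_le ?_ (by rw [norm_neg, hv1]))
          rw [norm_pow]
          exact pow_le_one₀ (norm_nonneg _) ht
        · by_contra hlt
          exact hns (padicAux_sq hp t v hv1 (not_le.1 hlt))
      exact one_ne_zero (padicAux_parity (1 : ℚ_[p]) (x 2 / x 1) (by rw [← key2, h1]; simp))
    · have ht2 : 1 < ‖t ^ 2‖ := by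
        rw [norm_pow]; exact one_lt_pow₀ ht two_ne_zero
      have h1 : ‖t ^ 2 - v‖ = ‖t ^ 2‖ := by
        rw [sub_eq_add_neg, Padic.add_eq_max_of_ne (by rw [norm_neg, hv1]; exact ht2.ne'),
          norm_neg, hv1, max_eq_left ht2.le]
      have := padicAux_parity t (x 2 / x 1) (by rw [← key2, h1, norm_pow])
      rw [this] at ht
      simp at ht
      linarith
end

section
/- Let p be an odd prime, let u ∈ ℚ_p be a p-adic unit (|u|_p = 1) that is not a square in ℚ_p, and set v := -u if p ≡ 1 (mod 4) and v := -1 if p ≡ 3 (mod 4). Then the quadratic form Q₍₄₎ on ℚ_p⁴ defined by Q₍₄₎(x) = x₀² − v·x₁² + p·x₂² − p·v·x₃² is definite (anisotropic): Q₍₄₎(x) = 0 implies x = 0. -/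
theorem padicAux_sub {p : ℕ} [Fact p.Prime] (a b : ℚ_[p]) : ‖a - b‖ ≤ max ‖a‖ ‖b‖ := by
  have h := Padic.nonarchimedean a (-b)
  rwa [← sub_eq_add_neg, norm_neg] at h

/-- Hensel: a unit congruent to a square is a square. -/
theorem padicAux_hensel {p : ℕ} [Fact p.Prime] (hp : p ≠ 2) (c a : ℚ_[p]) (hc : ‖c‖ = 1)
    (ha : ‖a‖ = 1) (h : ‖a ^ 2 - c‖ < 1) : IsSquare c := by
  let c' : ℤ_[p] := ⟨c, hc.le⟩
  let a' : ℤ_[p] := ⟨a, ha.le⟩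
  have h2 : ‖(2 : ℤ_[p])‖ = 1 := by
    have h3 : ‖((2 : ℕ) : ℚ_[p])‖ = 1 :=
      Padic.norm_natCast_eq_one_iff.2 ((Nat.coprime_primes Fact.out Nat.prime_two).2 hp)
    have h4 : ‖((2 : ℕ) : ℤ_[p])‖ = 1 := by
      rw [PadicInt.norm_def]; push_cast; push_cast at h3; exact h3
    exact_mod_cast h4
  have ha' : ‖a'‖ = 1 := ha
  have h' : ‖a' ^ 2 - c'‖ < 1 := h
  obtain ⟨z, hz, -⟩ := hensels_lemma (p := p) (R := ℤ_[p])
    (F := (Polynomial.X ^ 2 - Polynomial.C c' : Polynomial ℤ_[p])) (a := a') (by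
      simp [ha']
      rw [one_add_one_eq_two, h2, one_pow]
      exact h')
  have hz' : z ^ 2 - c' = 0 := by simpa using hz
  refine ⟨(z : ℚ_[p]), ?_⟩
  have h4 := congrArg (fun t : ℤ_[p] => (t : ℚ_[p])) (sub_eq_zero.1 hz')
  simp only [PadicInt.coe_pow] at h4
  rw [← pow_two, h4]

theorem padicAux_norm {p : ℕ} [Fact p.Prime] (hp : p ≠ 2) (v : ℚ_[p]) (hv : ‖v‖ = 1)
    (hs : ¬ IsSquare v) (a b : ℚ_[p]) :
    ∃ m : ℚ_[p], ‖a ^ 2 - v * b ^ 2‖ = ‖m‖ ^ 2 ∧ (m = 0 → a = 0 ∧ b = 0) := by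
  by_cases hab : ‖a‖ = ‖b‖
  · refine ⟨b, ?_, fun h => by simp_all⟩
    by_cases hb : b = 0
    · simp_all
    have hb' : ‖b‖ ≠ 0 := norm_ne_zero_iff.2 hb
    have ht : ‖a / b‖ = 1 := by rw [norm_div, hab, div_self hb']
    have h1 : ‖(a / b) ^ 2 - v‖ = 1 := by
      apply le_antisymm
      · refine (padicAux_sub _ _).trans ?_
        simp only [norm_pow, ht, hv]; norm_num
      · by_contra! h
        exact hs (padicAux_hensel hp v (a / b) hv ht h)
    have h2 : a ^ 2 - v * b ^ 2 = ((a / b) ^ 2 - v) * b ^ 2 := by field_simp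
    rw [h2, norm_mul, h1, norm_pow, one_mul]
  · have hne : ‖a ^ 2‖ ≠ ‖-(v * b ^ 2)‖ := by
      simp only [norm_neg, norm_mul, norm_pow, hv, one_mul]
      intro h
      exact hab ((pow_left_inj₀ (norm_nonneg _) (norm_nonneg _) two_ne_zero).1 h)
    have h := Padic.add_eq_max_of_ne hne
    rw [← sub_eq_add_neg] at h
    simp only [norm_neg, norm_mul, norm_pow, hv, one_mul] at h
    rcases lt_or_gt_of_ne hab with hl | hl
    · refine ⟨b, ?_, ?_⟩
      · rw [h, max_eq_right]; gcongr
      · rintro rfl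
        simp at hl
        exact absurd hl (not_lt.2 (norm_nonneg a))
    · refine ⟨a, ?_, ?_⟩
      · rw [h, max_eq_left]; gcongr
      · rintro rfl
        simp at hl
        exact absurd hl (not_lt.2 (norm_nonneg b))

theorem padicAux_neg_one {p : ℕ} [Fact p.Prime] (hp : p ≠ 2) :
    IsSquare (-1 : ℚ_[p]) ↔ p % 4 = 1 := by
  have hodd : p % 2 = 1 := ((Fact.out : p.Prime).eq_two_or_odd).resolve_left hp
  have key := ZMod.exists_sq_eq_neg_one_iff (p := p)
  constructor
  · rintro ⟨a, ha⟩
    have hn : ‖a‖ = 1 := by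
      have := congrArg norm ha
      simp only [norm_neg, norm_one, norm_mul] at this
      nlinarith [norm_nonneg a]
    let a' : ℤ_[p] := ⟨a, hn.le⟩
    have h1 : (-1 : ℤ_[p]) = a' * a' := by
      apply Subtype.ext
      push_cast
      exact ha
    have h2 : IsSquare (-1 : ZMod p) := ⟨PadicInt.toZMod a', by
      rw [← map_mul, ← h1]; simp⟩
    have := key.1 h2
    omega
  · intro h
    obtain ⟨y, hy⟩ := key.2 (by omega)
    obtain ⟨n, rfl⟩ := ZMod.natCast_zmod_surjective y
    have hd : (p : ℤ) ∣ (n : ℤ) ^ 2 + 1 := by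
      rw [← ZMod.intCast_zmod_eq_zero_iff_dvd]
      push_cast
      rw [pow_two, ← hy]; ring
    have hlt : ‖(n : ℚ_[p]) ^ 2 - (-1)‖ < 1 := by
      have := (Padic.norm_intCast_lt_one_iff (p := p)).2 hd
      push_cast at this
      simpa using this
    refine padicAux_hensel hp (-1) (n : ℚ_[p]) (by simp) ?_ hlt
    have h3 : ‖(n : ℚ_[p])‖ ≤ 1 := by
      simpa using Padic.norm_int_le_one (p := p) (n : ℤ)
    by_contra hne
    have hlt2 : ‖(n : ℚ_[p])‖ < 1 := lt_of_le_of_ne h3 hne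
    have h5 : ‖((n : ℚ_[p]) ^ 2 - (-1)) - (n : ℚ_[p]) ^ 2‖ < 1 := by
      refine (padicAux_sub _ _).trans_lt (max_lt hlt ?_)
      rw [norm_pow]
      exact pow_lt_one₀ (norm_nonneg _) hlt2 two_ne_zero
    have h6 : ((n : ℚ_[p]) ^ 2 - (-1)) - (n : ℚ_[p]) ^ 2 = 1 := by ring
    rw [h6, norm_one] at h5
    exact lt_irrefl _ h5

/-- For an odd prime `p`, with `u` a non-square `p`-adic unit and
`v = -u` if `p ≡ 1 (mod 4)`, `v = -1` if `p ≡ 3 (mod 4)`, the quaternary quadratic form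
`Q₍₄₎(x) = x₀² − v·x₁² + p·x₂² − p·v·x₃²` on `ℚ_p⁴` is definite (anisotropic). -/
theorem Padic.quadraticForm_dim4_anisotropic {p : ℕ} [Fact p.Prime] (hp : p ≠ 2)
    (u : ℚ_[p]) (hu : ‖u‖ = 1) (hu' : ¬ IsSquare u)
    (v : ℚ_[p]) (hv : v = if p % 4 = 1 then -u else -1) :
    ∀ x : Fin 4 → ℚ_[p],
      x 0 ^ 2 - v * x 1 ^ 2 + (p : ℚ_[p]) * x 2 ^ 2 - (p : ℚ_[p]) * v * x 3 ^ 2 = 0 → x = 0 := by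
  intro x hx
  have hneg := padicAux_neg_one (p := p) hp
  have hv1 : ‖v‖ = 1 := by
    rw [hv]; split_ifs <;> simp [hu]
  have hvs : ¬ IsSquare v := by
    rw [hv]
    split_ifs with h
    · intro hs
      apply hu'
      have := (hneg.2 h).mul hs
      simpa using this
    · exact fun hs => h (hneg.1 hs)
  obtain ⟨m, hm, hm0⟩ := padicAux_norm hp v hv1 hvs (x 0) (x 1)
  obtain ⟨n, hn, hn0⟩ := padicAux_norm hp v hv1 hvs (x 2) (x 3)
  have hpp : (1 : ℝ) < p := by exact_mod_cast (Fact.out : p.Prime).one_lt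
  have heq : x 0 ^ 2 - v * x 1 ^ 2 = -((p : ℚ_[p]) * (x 2 ^ 2 - v * x 3 ^ 2)) := by
    linear_combination hx
  have hnorm : ‖m‖ ^ 2 = (p : ℝ)⁻¹ * ‖n‖ ^ 2 := by
    rw [← hm, heq, norm_neg, norm_mul, hn, Padic.norm_p]
  have hnz : n = 0 := by
    by_contra hne
    have hmne : m ≠ 0 := by
      rintro rfl
      have h1 : 0 < ‖n‖ := norm_pos_iff.2 hne
      have h2 : 0 < (p : ℝ)⁻¹ * ‖n‖ ^ 2 := by positivity
      simp at hnorm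
      rcases hnorm with h | h
      · simp [h] at hpp
        norm_num at hpp
      · exact hne h
    rw [Padic.norm_eq_zpow_neg_valuation hne, Padic.norm_eq_zpow_neg_valuation hmne] at hnorm
    have hp0 : (p : ℝ) ≠ 0 := by positivity
    rw [← zpow_natCast, ← zpow_natCast, ← zpow_mul, ← zpow_mul, ← zpow_neg_one,
      ← zpow_add₀ hp0] at hnorm
    have := zpow_right_injective₀ (by positivity) hpp.ne' hnorm
    push_cast at this
    omega
  have hmz : m = 0 := by simpa [hnz] using hnorm
  obtain ⟨h0, h1⟩ := hm0 hmz
  obtain ⟨h2, h3⟩ := hn0 hnz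
  ext i
  fin_cases i <;> simp [h0, h1, h2, h3]
end

section
/- Let p be an odd prime, let u ∈ ℚ_p be a p-adic unit (|u|_p = 1) that is not a square in ℚ_p, and set v := -u if p ≡ 1 (mod 4) and v := -1 if p ≡ 3 (mod 4); let Q_+(x) = x₀² − v·x₁² + p·x₂² on ℚ_p³. Then Q_+ is, up to linear equivalence and scaling, the unique definite quadratic form on ℚ_p³: for every quadratic form Q on ℚ_p³ such that Q(x) = 0 implies x = 0, there exist c ∈ ℚ_p with c ≠ 0 and a ℚ_p-linear automorphism e of ℚ_p³ such that Q(e(x)) = c·Q_+(x) for all x ∈ ℚ_p³. -/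
namespace QplusAux

open PadicInt

variable {p : ℕ} [Fact p.Prime]

theorem toZMod_eq_zero_iff (x : ℤ_[p]) : toZMod x = 0 ↔ ‖x‖ < 1 := by
  rw [← RingHom.mem_ker, ker_toZMod, IsLocalRing.mem_maximalIdeal, PadicInt.mem_nonunits]

theorem toZMod_ne_zero {x : ℤ_[p]} (hx : ‖x‖ = 1) : toZMod x ≠ 0 := by
  intro h
  have := (toZMod_eq_zero_iff x).1 h
  linarith

theorem two_ne (hp : p ≠ 2) : (2 : ZMod p) ≠ 0 := by
  intro h
  have h2 : ((2 : ℕ) : ZMod p) = 0 := by exact_mod_cast h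
  rw [ZMod.natCast_eq_zero_iff] at h2
  exact hp ((Nat.prime_dvd_prime_iff_eq Fact.out Nat.prime_two).1 h2)

theorem exists_lift (a : ZMod p) : ∃ x : ℤ_[p], toZMod x = a := by
  refine ⟨((a.val : ℕ) : ℤ_[p]), ?_⟩
  rw [map_natCast, ZMod.natCast_zmod_val]

/-- Hensel: an integer whose residue is a nonzero square is a square. -/
theorem sq_of_residue (hp : p ≠ 2) (x : ℤ_[p]) (a : ZMod p) (ha : a ≠ 0)
    (h : toZMod x = a ^ 2) : ∃ y : ℤ_[p], x = y ^ 2 := by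
  obtain ⟨b, rfl⟩ := exists_lift a
  have hd : ‖2 * b‖ = 1 := by
    refine le_antisymm (PadicInt.norm_le_one _) (not_lt.1 fun hlt => ?_)
    rw [← toZMod_eq_zero_iff, map_mul] at hlt
    rcases mul_eq_zero.1 hlt with h2 | h2
    · exact two_ne hp (by rwa [map_ofNat] at h2)
    · exact ha h2
  have hz : ‖b ^ 2 - x‖ < 1 := by
    rw [← toZMod_eq_zero_iff, map_sub, map_pow, h, sub_self]
  have hH := hensels_lemma (p := p) (R := ℤ_[p])
    (F := (Polynomial.X ^ 2 - Polynomial.C x)) (a := b)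
    (by
      simp only [map_sub, map_pow, Polynomial.aeval_X, Polynomial.aeval_C,
        Polynomial.derivative_X_pow, Polynomial.derivative_C, map_mul]
      simpa [hd] using hz)
  obtain ⟨z, hz, -⟩ := hH
  refine ⟨z, ?_⟩
  simp at hz
  linear_combination -hz

theorem toInt {x : ℚ_[p]} (hx : ‖x‖ = 1) : ∃ y : ℤ_[p], (y : ℚ_[p]) = x ∧ ‖y‖ = 1 :=
  ⟨⟨x, hx.le⟩, rfl, hx⟩

/-- The product of two nonsquare units is a square. -/
theorem mul_sq (hp : p ≠ 2) {x y : ℚ_[p]} (hx : ‖x‖ = 1) (hy : ‖y‖ = 1)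
    (hx' : ¬ IsSquare x) (hy' : ¬ IsSquare y) : ∃ r, x * y = r ^ 2 := by
  obtain ⟨x, rfl, hx⟩ := toInt hx
  obtain ⟨y, rfl, hy⟩ := toInt hy
  have key : ∀ z : ℤ_[p], ‖z‖ = 1 → ¬ IsSquare (z : ℚ_[p]) → quadraticChar (ZMod p) (toZMod z) = -1 := by
    intro z hz hz'
    rw [quadraticChar_neg_one_iff_not_isSquare]
    rintro ⟨a, ha⟩
    have ha0 : a ≠ 0 := by
      rintro rfl
      exact toZMod_ne_zero hz (by simpa using ha)
    obtain ⟨y, rfl⟩ := sq_of_residue hp z a ha0 (by rw [ha, sq])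
    exact hz' ⟨y, by push_cast; ring⟩
  have h1 := key x hx hx'
  have h2 := key y hy hy'
  have h3 : quadraticChar (ZMod p) (toZMod (x * y)) = 1 := by
    rw [map_mul, map_mul, h1, h2]; norm_num
  have hne : toZMod (x * y) ≠ 0 := toZMod_ne_zero (by rw [norm_mul]; simp_all)
  rw [quadraticChar_one_iff_isSquare hne] at h3
  obtain ⟨a, ha⟩ := h3
  have ha0 : a ≠ 0 := by
    rintro rfl
    exact hne (by simpa using ha)
  obtain ⟨r, hr⟩ := sq_of_residue hp (x * y) a ha0 (by rw [ha, sq])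
  exact ⟨r, by
      have := congrArg (fun z : ℤ_[p] => (z : ℚ_[p])) hr
      push_cast at this
      exact this⟩

/-- `s² - v t²` represents every unit. -/
theorem represents (hp : p ≠ 2) {v w : ℚ_[p]} (hv : ‖v‖ = 1) (hw : ‖w‖ = 1) :
    ∃ s t : ℚ_[p], w = s ^ 2 - v * t ^ 2 := by
  obtain ⟨v, rfl, hv⟩ := toInt hv
  obtain ⟨w, rfl, hw⟩ := toInt hw
  have hv0 := toZMod_ne_zero hv
  have hw0 := toZMod_ne_zero hw
  obtain ⟨a, b, hab⟩ : ∃ a b : ZMod p, a ^ 2 - toZMod v * b ^ 2 = toZMod w := by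
    obtain ⟨a, b, hab⟩ := FiniteField.exists_root_sum_quadratic
      (f := (Polynomial.X ^ 2 - Polynomial.C (toZMod w) : Polynomial (ZMod p)))
      (g := Polynomial.C (-toZMod v) * Polynomial.X ^ 2)
      (Polynomial.degree_X_pow_sub_C (by decide) _)
      (Polynomial.degree_C_mul_X_pow 2 (neg_ne_zero.2 hv0))
      (by rw [ZMod.card]; exact (Nat.Prime.eq_two_or_odd (Fact.out : p.Prime)).resolve_left hp)
    refine ⟨a, b, ?_⟩
    simp at hab
    linear_combination hab
  obtain ⟨t, rfl⟩ := exists_lift b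
  by_cases ha : a = 0
  · subst ha
    have hb : toZMod t ≠ 0 := by
      intro hb
      rw [hb] at hab
      exact hw0 (by rw [← hab]; ring)
    obtain ⟨y, hy⟩ := sq_of_residue hp (-(v * w)) (toZMod v * toZMod t) (mul_ne_zero hv0 hb) (by
      rw [map_neg, map_mul, ← hab]; ring)
    have hvne : (v : ℚ_[p]) ≠ 0 := by
      intro h
      have : v = 0 := Subtype.ext h
      simp [this] at hv
    have hy' : -((v : ℚ_[p]) * w) = (y : ℚ_[p]) ^ 2 := by
      have := congrArg (fun z : ℤ_[p] => (z : ℚ_[p])) hy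
      push_cast at this
      exact this
    refine ⟨0, y / v, ?_⟩
    field_simp
    linear_combination -hy'
  · obtain ⟨y, hy⟩ := sq_of_residue hp (w + v * t ^ 2) a ha (by
      rw [map_add, map_mul, map_pow, ← hab]; ring)
    have hy' : (w : ℚ_[p]) + v * (t : ℚ_[p]) ^ 2 = (y : ℚ_[p]) ^ 2 := by
      have := congrArg (fun z : ℤ_[p] => (z : ℚ_[p])) hy
      push_cast at this
      exact this
    exact ⟨y, t, by linear_combination hy'⟩

theorem v_spec (hp : p ≠ 2) (u : ℚ_[p]) (hu : ‖u‖ = 1) (hu' : ¬ IsSquare u)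
    (v : ℚ_[p]) (hv : v = if p % 4 = 1 then -u else -1) : ‖v‖ = 1 ∧ ¬ IsSquare v := by
  by_cases h4 : p % 4 = 1
  · rw [if_pos h4] at hv
    subst hv
    refine ⟨by simpa using hu, ?_⟩
    rintro ⟨r, hr⟩
    obtain ⟨a, ha⟩ := (ZMod.exists_sq_eq_neg_one_iff (p := p)).2 (by omega)
    have ha0 : a ≠ 0 := by
      rintro rfl
      simp at ha
    obtain ⟨i, hi⟩ := sq_of_residue hp (-1) a ha0 (by rw [map_neg, map_one, ha, sq])
    have hi' : (-1 : ℚ_[p]) = (i : ℚ_[p]) ^ 2 := by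
      have := congrArg (fun z : ℤ_[p] => (z : ℚ_[p])) hi
      push_cast at this
      exact this
    exact hu' ⟨i * r, by linear_combination (-1 : ℚ_[p]) * hr + r ^ 2 * hi'⟩
  · rw [if_neg h4] at hv
    subst hv
    refine ⟨by simp, ?_⟩
    rintro ⟨r, hr⟩
    have hn : ‖r‖ = 1 := by
      have h1 : ‖r‖ * ‖r‖ = 1 := by rw [← norm_mul, ← hr]; simp
      nlinarith [norm_nonneg r]
    obtain ⟨r, rfl, -⟩ := toInt hn
    have hr' : (-1 : ℤ_[p]) = r * r := Subtype.ext (by push_cast; exact hr)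
    have h3 : p % 4 ≠ 3 := (ZMod.exists_sq_eq_neg_one_iff (p := p)).1
      ⟨toZMod r, by rw [← map_mul, ← hr', map_neg, map_one]⟩
    have := (Nat.Prime.eq_two_or_odd (Fact.out : p.Prime)).resolve_left hp
    omega

theorem p_ne : (p : ℚ_[p]) ≠ 0 := by
  exact_mod_cast (Fact.out : p.Prime).ne_zero

theorem unit_part {x : ℚ_[p]} (hx : x ≠ 0) : ∃ g : ℚ_[p], ‖g‖ = 1 ∧ x = g * (p : ℚ_[p]) ^ x.valuation := by
  have hp0 : (p : ℝ) ≠ 0 := by exact_mod_cast (Fact.out : p.Prime).ne_zero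
  refine ⟨x / (p : ℚ_[p]) ^ x.valuation, ?_, ?_⟩
  · rw [norm_div, Padic.norm_eq_zpow_neg_valuation hx, Padic.norm_p_zpow]
    exact div_self (zpow_ne_zero _ hp0)
  · rw [div_mul_cancel₀ _ (zpow_ne_zero _ p_ne)]

theorem even_part {x : ℚ_[p]} (hx : x ≠ 0) (h : x.valuation % 2 = 0) :
    ∃ g k : ℚ_[p], ‖g‖ = 1 ∧ k ≠ 0 ∧ x = g * k ^ 2 := by
  obtain ⟨g, hg, hx'⟩ := unit_part hx
  refine ⟨g, (p : ℚ_[p]) ^ (x.valuation / 2), hg, zpow_ne_zero _ p_ne, ?_⟩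
  rw [← zpow_natCast, ← zpow_mul]
  have : x.valuation / 2 * ((2 : ℕ) : ℤ) = x.valuation := by push_cast; omega
  rw [this]; exact hx'

theorem odd_part {x : ℚ_[p]} (hx : x ≠ 0) (h : x.valuation % 2 = 1) :
    ∃ g k : ℚ_[p], ‖g‖ = 1 ∧ k ≠ 0 ∧ x = p * g * k ^ 2 := by
  obtain ⟨g, hg, hx'⟩ := unit_part hx
  refine ⟨g, (p : ℚ_[p]) ^ (x.valuation / 2), hg, zpow_ne_zero _ p_ne, ?_⟩
  rw [← zpow_natCast, ← zpow_mul]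
  have : x.valuation = 1 + x.valuation / 2 * ((2 : ℕ) : ℤ) := by push_cast; omega
  rw [this, zpow_add₀ p_ne, zpow_one] at hx'
  linear_combination hx'

theorem val_div {a b : ℚ_[p]} (ha : a ≠ 0) (hb : b ≠ 0) :
    (b / a).valuation = b.valuation - a.valuation := by
  have h := Padic.valuation_mul (div_ne_zero hb ha) ha
  rw [div_mul_cancel₀ _ ha] at h
  omega

/-- The linear automorphism used in the normal form. -/
theorem exists_equiv {K : Type*} [Field K] (s t v k m : K) (h : s ^ 2 - v * t ^ 2 ≠ 0)
    (hk : k ≠ 0) (hm : m ≠ 0) : ∃ e : (Fin 3 → K) ≃ₗ[K] (Fin 3 → K),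
      ∀ x, e x 0 = s * x 0 + v * t * x 1 ∧ e x 1 = k * (t * x 0 + s * x 1) ∧ e x 2 = m * x 2 := by
  let f : (Fin 3 → K) →ₗ[K] (Fin 3 → K) :=
    { toFun := fun x => ![s * x 0 + v * t * x 1, k * (t * x 0 + s * x 1), m * x 2]
      map_add' := by
        intro x y
        ext i
        fin_cases i <;> simp <;> ring
      map_smul' := by
        intro c x
        ext i
        fin_cases i <;> simp <;> ring }
  have hf : Function.Injective f := by
    rw [injective_iff_map_eq_zero]
    intro x hx
    have h0 : s * x 0 + v * t * x 1 = 0 := congrFun hx 0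
    have h1 : k * (t * x 0 + s * x 1) = 0 := congrFun hx 1
    have h2 : m * x 2 = 0 := congrFun hx 2
    have h1' := (mul_eq_zero.1 h1).resolve_left hk
    have e0 : x 0 = 0 := (mul_eq_zero.1 (by linear_combination s * h0 - v * t * h1' :
      (s ^ 2 - v * t ^ 2) * x 0 = 0)).resolve_left h
    have e1 : x 1 = 0 := (mul_eq_zero.1 (by linear_combination s * h1' - t * h0 :
      (s ^ 2 - v * t ^ 2) * x 1 = 0)).resolve_left h
    have e2 := (mul_eq_zero.1 h2).resolve_left hm
    ext i
    fin_cases i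
    · exact e0
    · exact e1
    · exact e2
  exact ⟨LinearEquiv.ofInjectiveEndo f hf, fun x => ⟨rfl, rfl, rfl⟩⟩

/-- Core case: diagonal form whose first two coefficients have valuations of equal parity. -/
theorem core (hp : p ≠ 2) {v : ℚ_[p]} (hv : ‖v‖ = 1) (hv' : ¬ IsSquare v)
    {a b d : ℚ_[p]} (ha : a ≠ 0) (hb : b ≠ 0) (hd : d ≠ 0)
    (hpar : a.valuation % 2 = b.valuation % 2)
    (Q : QuadraticForm ℚ_[p] (Fin 3 → ℚ_[p])) (hQ : ∀ x, Q x = 0 → x = 0)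
    (L : (Fin 3 → ℚ_[p]) ≃ₗ[ℚ_[p]] (Fin 3 → ℚ_[p]))
    (hL : ∀ x, Q (L x) = a * x 0 ^ 2 + b * x 1 ^ 2 + d * x 2 ^ 2) :
    ∃ (c : ℚ_[p]) (_ : c ≠ 0) (e : (Fin 3 → ℚ_[p]) ≃ₗ[ℚ_[p]] (Fin 3 → ℚ_[p])),
      ∀ x : Fin 3 → ℚ_[p],
        Q (e x) = c * (x 0 ^ 2 - v * x 1 ^ 2 + (p : ℚ_[p]) * x 2 ^ 2) := by
  have aniso : ∀ x y z : ℚ_[p], a * x ^ 2 + b * y ^ 2 + d * z ^ 2 = 0 → y = 0 ∧ z = 0 := by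
    intro x y z h
    have h1 := hL ![x, y, z]
    have h2 : ![x, y, z] = 0 := L.map_eq_zero_iff.1 (hQ _ (by rw [h1]; simpa using h))
    exact ⟨congrFun h2 1, congrFun h2 2⟩
  have hv0 : v ≠ 0 := by
    rintro rfl
    simp at hv
  obtain ⟨g, l, hg, hl, hgl⟩ := even_part (div_ne_zero hb ha) (by rw [val_div ha hb]; omega)
  have hb' : b = a * g * l ^ 2 := by
    rw [div_eq_iff ha] at hgl
    linear_combination hgl
  have hgns : ¬ IsSquare (-g) := by
    rintro ⟨r, hr⟩
    have := (aniso (r * l) 1 0 (by rw [hb']; linear_combination -a * l ^ 2 * hr)).1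
    exact one_ne_zero this
  obtain ⟨r, hr⟩ := mul_sq hp (by simpa using hg) hv hgns hv'
  have hr0 : r ≠ 0 := by
    rintro rfl
    have : -g * v = 0 := by rw [hr]; ring
    rcases mul_eq_zero.1 this with h | h
    · have : g = 0 := neg_eq_zero.1 h
      simp [this] at hg
    · exact hv0 h
  -- scale the second coordinate
  obtain ⟨k, hk, hbk⟩ : ∃ k : ℚ_[p], k ≠ 0 ∧ b * k ^ 2 = -v * a := by
    refine ⟨v / (r * l), div_ne_zero hv0 (mul_ne_zero hr0 hl), ?_⟩
    rw [hb']
    field_simp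
    linear_combination (-1 : ℚ_[p]) * hr
  rcases Int.emod_two_eq_zero_or_one (d / a).valuation with he | ho
  · exfalso
    obtain ⟨w, m, hw, hm, hwm⟩ := even_part (div_ne_zero hd ha) he
    rw [div_eq_iff ha] at hwm
    obtain ⟨s, t, hst⟩ := represents hp hv (w := -w) (by simpa using hw)
    have := (aniso (s * m) (k * t * m) 1 (by
      rw [hwm]; linear_combination t ^ 2 * m ^ 2 * hbk - a * m ^ 2 * hst)).2
    exact one_ne_zero this
  · obtain ⟨w, m, hw, hm, hwm⟩ := odd_part (div_ne_zero hd ha) ho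
    rw [div_eq_iff ha] at hwm
    have hw0 : w ≠ 0 := by
      rintro rfl
      simp at hw
    obtain ⟨s, t, hst⟩ := represents hp hv hw
    obtain ⟨e, he⟩ := exists_equiv s t v k m⁻¹ (by rw [← hst]; exact hw0) hk (inv_ne_zero hm)
    refine ⟨a * w, mul_ne_zero ha hw0, e.trans L, fun x => ?_⟩
    obtain ⟨h0, h1, h2⟩ := he x
    rw [LinearEquiv.trans_apply, hL, h0, h1, h2]
    have hdm : d * (m⁻¹ * x 2) ^ 2 = p * w * a * x 2 ^ 2 := by
      rw [hwm]; field_simp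
    rw [hdm]
    linear_combination (t * x 0 + s * x 1) ^ 2 * hbk - a * (x 0 ^ 2 - v * x 1 ^ 2) * hst

theorem diagonalize (Q : QuadraticForm ℚ_[p] (Fin 3 → ℚ_[p])) :
    ∃ (w : Fin 3 → ℚ_[p]) (L : (Fin 3 → ℚ_[p]) ≃ₗ[ℚ_[p]] (Fin 3 → ℚ_[p])),
      ∀ x, Q (L x) = w 0 * x 0 ^ 2 + w 1 * x 1 ^ 2 + w 2 * x 2 ^ 2 := by
  have : Invertible (2 : ℚ_[p]) := invertibleOfNonzero two_ne_zero
  have key := QuadraticForm.equivalent_weightedSumSquares Q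
  rw [Module.finrank_fin_fun] at key
  obtain ⟨w, ⟨f⟩⟩ := key
  refine ⟨w, f.symm.toLinearEquiv, fun x => ?_⟩
  have h := f.symm.map_app x
  change Q (f.symm x) = _
  rw [h, QuadraticMap.weightedSumSquares_apply, Fin.sum_univ_three]
  simp [sq]

end QplusAux

/-- For an odd prime `p`, with `u` a non-square `p`-adic unit and
`v = -u` if `p ≡ 1 (mod 4)`, `v = -1` if `p ≡ 3 (mod 4)`, the form
`Q₊(x) = x₀² − v·x₁² + p·x₂²` is, up to linear equivalence and scaling, the unique
definite quadratic form on `ℚ_p³`: every anisotropic quadratic form `Q` on `ℚ_p³`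
satisfies `Q ∘ e = c · Q₊` for some nonzero scalar `c` and linear automorphism `e`. -/
theorem Padic.anisotropic_dim3_equivalent_to_Qplus {p : ℕ} [Fact p.Prime] (hp : p ≠ 2)
    (u : ℚ_[p]) (hu : ‖u‖ = 1) (hu' : ¬ IsSquare u)
    (v : ℚ_[p]) (hv : v = if p % 4 = 1 then -u else -1)
    (Q : QuadraticForm ℚ_[p] (Fin 3 → ℚ_[p]))
    (hQ : ∀ x, Q x = 0 → x = 0) :
    ∃ (c : ℚ_[p]) (_ : c ≠ 0) (e : (Fin 3 → ℚ_[p]) ≃ₗ[ℚ_[p]] (Fin 3 → ℚ_[p])),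
      ∀ x : Fin 3 → ℚ_[p],
        Q (e x) = c * (x 0 ^ 2 - v * x 1 ^ 2 + (p : ℚ_[p]) * x 2 ^ 2) := by
  obtain ⟨hv1, hv2⟩ := QplusAux.v_spec hp u hu hu' v hv
  obtain ⟨w, L, hL⟩ := QplusAux.diagonalize Q
  have hw : ∀ i, w i ≠ 0 := by
    intro i hi
    have h1 := hL (Pi.single i 1)
    have h2 : Q (L (Pi.single i 1)) = 0 := by
      rw [h1]
      fin_cases i <;> simp at hi <;> simp [hi]
    have h3 := L.map_eq_zero_iff.1 (hQ _ h2)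
    have h4 := congrFun h3 i
    simp at h4
  have perm : ∀ σ : Equiv.Perm (Fin 3), ∀ x,
      Q ((LinearEquiv.funCongrLeft ℚ_[p] ℚ_[p] σ).trans L x)
        = w 0 * x (σ 0) ^ 2 + w 1 * x (σ 1) ^ 2 + w 2 * x (σ 2) ^ 2 := by
    intro σ x
    rw [LinearEquiv.trans_apply, hL]
    rfl
  by_cases h01 : (w 0).valuation % 2 = (w 1).valuation % 2
  · exact QplusAux.core hp hv1 hv2 (hw 0) (hw 1) (hw 2) h01 Q hQ L hL
  by_cases h02 : (w 0).valuation % 2 = (w 2).valuation % 2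
  · refine QplusAux.core hp hv1 hv2 (hw 0) (hw 2) (hw 1) h02 Q hQ
      ((LinearEquiv.funCongrLeft ℚ_[p] ℚ_[p] (Equiv.swap (1 : Fin 3) 2)).trans L) (fun x => ?_)
    rw [perm, show Equiv.swap (1 : Fin 3) 2 0 = 0 by decide,
        show Equiv.swap (1 : Fin 3) 2 1 = 2 by decide, show Equiv.swap (1 : Fin 3) 2 2 = 1 by decide]
    ring
  · refine QplusAux.core hp hv1 hv2 (hw 2) (hw 1) (hw 0) (by omega) Q hQ
      ((LinearEquiv.funCongrLeft ℚ_[p] ℚ_[p] (Equiv.swap (0 : Fin 3) 2)).trans L) (fun x => ?_)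
    rw [perm, show Equiv.swap (0 : Fin 3) 2 0 = 2 by decide,
      show Equiv.swap (0 : Fin 3) 2 1 = 1 by decide, show Equiv.swap (0 : Fin 3) 2 2 = 0 by decide]
    ring
end

section
/- Let p be a prime and κ ∈ ℚ_p such that −κ is not a square in ℚ_p (hence κ ≠ 0 and 1 + κ·α² ≠ 0 for every α ∈ ℚ_p). Let A_κ := diag(1, κ) ∈ M₂(ℚ_p) and, for α ∈ ℚ_p, define R(α) := (1 + κα²)⁻¹ · [[1 − κα², −2κα], [2α, 1 − κα²]]. Then: (i) for every α ∈ ℚ_p, R(α)ᵀ·A_κ·R(α) = A_κ and det R(α) = 1; (ii) conversely, every L ∈ M₂(ℚ_p) with Lᵀ·A_κ·L = A_κ and det L = 1 satisfies L = −I₂ or L = R(α) for some α ∈ ℚ_p; (iii) for all α, β ∈ ℚ_p with 1 − κ·α·β ≠ 0, R(α)·R(β) = R((α + β)/(1 − κ·α·β)). -/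
open scoped Matrix

/-- The rotation matrix `R(α)` parameterizing `SO(2,ℚ_p)_κ`. -/
noncomputable def PadicSO2.R {p : ℕ} [Fact p.Prime] (κ : ℚ_[p]) (α : ℚ_[p]) :
    Matrix (Fin 2) (Fin 2) ℚ_[p] :=
  (1 + κ * α ^ 2)⁻¹ •
    Matrix.of ![![1 - κ * α ^ 2, -(2 * κ * α)], ![2 * α, 1 - κ * α ^ 2]]

theorem PadicSO2.den_ne {p : ℕ} [Fact p.Prime] (κ : ℚ_[p]) (hκ : ¬ IsSquare (-κ))
    (α : ℚ_[p]) : 1 + κ * α ^ 2 ≠ 0 := by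
  intro h
  have hα : α ≠ 0 := by
    rintro rfl
    simp at h
  apply hκ
  refine ⟨α⁻¹, ?_⟩
  field_simp
  linear_combination -h

/-- Parameterization of `SO(2,ℚ_p)_κ` for `−κ` a non-square: (i) every `R(α)` preserves
the Gram matrix `A_κ = diag(1,κ)` and has determinant one; (ii) every element of
`SO(2,ℚ_p)_κ` is `−I₂` or of the form `R(α)`; (iii) the composition law
`R(α)·R(β) = R((α+β)/(1−καβ))` holds whenever `1 − καβ ≠ 0`. -/
theorem PadicSO2.param {p : ℕ} [Fact p.Prime] (κ : ℚ_[p]) (hκ : ¬ IsSquare (-κ))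
    (A : Matrix (Fin 2) (Fin 2) ℚ_[p]) (hA : A = Matrix.diagonal ![1, κ]) :
    (∀ α : ℚ_[p],
        (PadicSO2.R κ α).transpose * A * PadicSO2.R κ α = A ∧ (PadicSO2.R κ α).det = 1) ∧
    (∀ L : Matrix (Fin 2) (Fin 2) ℚ_[p], L.transpose * A * L = A → L.det = 1 →
        L = -1 ∨ ∃ α : ℚ_[p], L = PadicSO2.R κ α) ∧
    (∀ α β : ℚ_[p], 1 - κ * α * β ≠ 0 →
        PadicSO2.R κ α * PadicSO2.R κ β = PadicSO2.R κ ((α + β) / (1 - κ * α * β))) := by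
  have hden := PadicSO2.den_ne κ hκ
  have hκ0 : κ ≠ 0 := by
    rintro rfl
    exact hκ (by simp)
  subst hA
  refine ⟨fun α => ⟨?_, ?_⟩, fun L h hd => ?_, fun α β hab => ?_⟩
  · have h1 := hden α
    ext i j
    fin_cases i <;> fin_cases j <;>
      simp [PadicSO2.R, Matrix.mul_apply, Fin.sum_univ_two, Matrix.diagonal] <;>
      field_simp <;> ring
  · have h1 := hden α
    simp [PadicSO2.R, Matrix.det_fin_two]
    field_simp
    ring
  · have e00 := congrFun (congrFun h 0) 0
    have e01 := congrFun (congrFun h 0) 1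
    simp [Matrix.mul_apply, Fin.sum_univ_two, Matrix.diagonal] at e00 e01
    rw [Matrix.det_fin_two] at hd
    have hdd : L 1 1 = L 0 0 := by
      linear_combination (-L 1 1) * e00 + L 0 0 * hd + L 1 0 * e01
    have hb : L 0 1 = -(κ * L 1 0) := by
      linear_combination (-L 0 1) * e00 + L 0 0 * e01 - κ * L 1 0 * hd
    by_cases ha : 1 + L 0 0 = 0
    · left
      have ha' : L 0 0 = -1 := by linear_combination ha
      have hc : L 1 0 = 0 := by
        have : κ * (L 1 0) ^ 2 = 0 := by
          rw [ha'] at e00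
          linear_combination e00
        simpa [hκ0] using this
      ext i j
      fin_cases i <;> fin_cases j <;> simp [hdd, hb, hc, ha']
    · right
      refine ⟨L 1 0 / (1 + L 0 0), ?_⟩
      have h2 : (1 + κ * (L 1 0 / (1 + L 0 0)) ^ 2)⁻¹ = (1 + L 0 0) / 2 := by
        rw [inv_eq_iff_eq_inv, inv_div]
        field_simp
        linear_combination e00
      ext i j
      fin_cases i <;> fin_cases j <;> simp [PadicSO2.R, h2, hdd, hb] <;> field_simp
      · linear_combination e00
      · linear_combination e00
  · have h1 := hden α
    have h2 := hden β
    have h3 := hden ((α + β) / (1 - κ * α * β))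
    have h4 : (1 + κ * ((α + β) / (1 - κ * α * β)) ^ 2)⁻¹ =
        (1 - κ * α * β) ^ 2 * ((1 + κ * α ^ 2)⁻¹ * (1 + κ * β ^ 2)⁻¹) := by
      rw [inv_eq_iff_eq_inv]
      field_simp
      ring
    ext i j
    fin_cases i <;> fin_cases j <;>
      simp [PadicSO2.R, Matrix.mul_apply, Fin.sum_univ_two, h4] <;>
      field_simp <;> ring
end

section
/- Let p be a prime and κ ∈ ℚ_p such that −κ is not a square in ℚ_p. Let λ be an additive Haar measure on ℚ_p and define the measure μ_κ := λ.withDensity(α ↦ |1 + κ·α²|_p⁻¹). Then μ_κ is invariant under the group law of SO(2,ℚ_p)_κ read in the parameter α: for every β ∈ ℚ_p, the pushforward of μ_κ under the map α ↦ (α + β)/(1 − κ·α·β) equals μ_κ. (Here division by zero is interpreted by the convention x/0 = 0; the single point where 1 − κ·α·β = 0 is a λ-null set.) -/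
open MeasureTheory

namespace PadicSO2
open Metric

lemma ball_step {p : ℕ} [Fact p.Prime] [MeasurableSpace ℚ_[p]] [BorelSpace ℚ_[p]]
    (lam : Measure ℚ_[p]) [lam.IsAddHaarMeasure] (n : ℤ) :
    lam (closedBall 0 ((p:ℝ) ^ (-n))) = p * lam (closedBall 0 ((p:ℝ) ^ (-(n+1)))) := by
  have hp : (0:ℝ) < p := by exact_mod_cast (Fact.out : p.Prime).pos
  have hp0 : (p : ℚ_[p]) ≠ 0 := by exact_mod_cast (Fact.out : p.Prime).ne_zero
  have hpn : (p : ℚ_[p]) ^ n ≠ 0 := zpow_ne_zero _ hp0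
  have hnorm : ‖(p : ℚ_[p]) ^ n‖ = (p:ℝ) ^ (-n) := Padic.norm_p_zpow n
  have hcover : closedBall (0 : ℚ_[p]) ((p:ℝ) ^ (-n))
      = ⋃ i ∈ Finset.range p, closedBall ((i : ℚ_[p]) * (p : ℚ_[p]) ^ n) ((p:ℝ) ^ (-(n+1))) := by
    ext x
    simp only [mem_closedBall, Set.mem_iUnion, Finset.mem_range, exists_prop,
      dist_eq_norm, sub_zero]
    constructor
    · intro hx
      have hy : ‖x / (p : ℚ_[p]) ^ n‖ ≤ 1 := by
        rw [norm_div, hnorm]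
        exact div_le_one_of_le₀ hx (by positivity)
      obtain ⟨z, hz⟩ : ∃ z : ℤ_[p], (z : ℚ_[p]) = x / (p : ℚ_[p]) ^ n := ⟨⟨_, hy⟩, rfl⟩
      obtain ⟨i, hi, hmem⟩ := PadicInt.exists_mem_range z
      refine ⟨i, hi, ?_⟩
      rw [IsLocalRing.mem_maximalIdeal, PadicInt.mem_nonunits, PadicInt.norm_def] at hmem
      have h1 : ‖x / (p : ℚ_[p]) ^ n - i‖ < 1 := by
        rw [PadicInt.coe_sub, PadicInt.coe_natCast, hz] at hmem
        exact hmem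
      have h2 : x - i * (p : ℚ_[p]) ^ n = (x / (p : ℚ_[p]) ^ n - i) * (p : ℚ_[p]) ^ n := by
        field_simp
      rw [Padic.norm_le_pow_iff_norm_lt_pow_add_one, h2, norm_mul, hnorm,
        show -(n+1)+1 = -n by ring]
      have : (0:ℝ) < (p:ℝ) ^ (-n) := by positivity
      nlinarith
    · rintro ⟨i, hi, h⟩
      have h3 : ‖(i : ℚ_[p]) * (p : ℚ_[p]) ^ n‖ ≤ (p:ℝ) ^ (-n) := by
        rw [norm_mul, hnorm]
        have : ‖(i : ℚ_[p])‖ ≤ 1 := by simpa using Padic.norm_int_le_one (p := p) (i : ℤ)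
        have : (0:ℝ) < (p:ℝ) ^ (-n) := by positivity
        nlinarith
      have h4 : ‖x - i * (p : ℚ_[p]) ^ n‖ ≤ (p:ℝ) ^ (-n) := by
        rw [Padic.norm_le_pow_iff_norm_lt_pow_add_one, show -(n+1)+1 = -n by ring] at h
        exact h.le
      calc ‖x‖ = ‖(x - i * (p : ℚ_[p]) ^ n) + i * (p : ℚ_[p]) ^ n‖ := by ring_nf
        _ ≤ _ := Padic.nonarchimedean _ _
        _ ≤ _ := max_le h4 h3
  rw [hcover, measure_biUnion_finset]
  · have : ∀ c : ℚ_[p], ∀ r, lam (closedBall c r) = lam (closedBall 0 r) := by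
      intro c r
      have := measure_preimage_add lam c (closedBall c r)
      rw [← this]
      congr 1
      ext x
      simp [dist_eq_norm]
    simp only [this, Finset.sum_const, Finset.card_range, nsmul_eq_mul]
  · intro i hi j hj hij
    rw [Function.onFun, Set.disjoint_left]
    intro x hxi hxj
    simp only [mem_closedBall, dist_eq_norm] at hxi hxj
    rw [Padic.norm_le_pow_iff_norm_lt_pow_add_one, show -(n+1)+1 = -n by ring] at hxi hxj
    have h5 : ‖(((i:ℤ) - (j:ℤ) : ℤ) : ℚ_[p]) * (p : ℚ_[p]) ^ n‖ < (p:ℝ) ^ (-n) := by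
      have : (((i:ℤ) - (j:ℤ) : ℤ) : ℚ_[p]) * (p : ℚ_[p]) ^ n
        = (x - j * (p : ℚ_[p]) ^ n) + -(x - i * (p : ℚ_[p]) ^ n) := by push_cast; ring
      rw [this]
      refine (Padic.nonarchimedean _ _).trans_lt (max_lt hxj ?_)
      rwa [norm_neg]
    rw [norm_mul, hnorm] at h5
    have h6 : ‖(((i:ℤ) - (j:ℤ) : ℤ) : ℚ_[p])‖ < 1 := by
      have : (0:ℝ) < (p:ℝ) ^ (-n) := by positivity
      by_contra h; push Not at h; nlinarith
    rw [Padic.norm_intCast_lt_one_iff] at h6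
    have hi' : i < p := by simpa using hi
    have hj' : j < p := by simpa using hj
    apply hij
    have := Int.eq_zero_of_abs_lt_dvd h6 (by rw [abs_lt]; constructor <;> omega)
    omega
  · intro i _
    exact isClosed_closedBall.measurableSet

lemma ball_zpow {p : ℕ} [Fact p.Prime] [MeasurableSpace ℚ_[p]] [BorelSpace ℚ_[p]]
    (lam : Measure ℚ_[p]) [lam.IsAddHaarMeasure] (n : ℤ) :
    lam (closedBall 0 ((p:ℝ) ^ (-n))) = (p:ENNReal) ^ (-n) * lam (closedBall 0 1) := by
  have hp0 : (p : ENNReal) ≠ 0 := by exact_mod_cast (Fact.out : p.Prime).ne_zero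
  have hpt : (p : ENNReal) ≠ ⊤ := ENNReal.natCast_ne_top p
  induction n using Int.induction_on with
  | zero => simp
  | succ n ih =>
    rw [ball_step] at ih
    have : (p:ENNReal) ^ (-(n:ℤ)) = p * (p:ENNReal) ^ (-((n:ℤ)+1)) := by
      rw [show -(n:ℤ) = 1 + -((n:ℤ)+1) by ring, ENNReal.zpow_add hp0 hpt, zpow_one]
      try ring_nf
    rw [this, mul_assoc] at ih
    exact (ENNReal.mul_right_inj hp0 hpt).1 ih
  | pred n ih =>
    rw [ball_step, show -(n:ℤ) - 1 + 1 = -n by ring, ih, ← mul_assoc]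
    rw [show -(-(n:ℤ) - 1) = 1 + -(-(n:ℤ)) by ring, ENNReal.zpow_add hp0 hpt, zpow_one]

lemma ball_norm {p : ℕ} [Fact p.Prime] [MeasurableSpace ℚ_[p]] [BorelSpace ℚ_[p]]
    (lam : Measure ℚ_[p]) [lam.IsAddHaarMeasure] {a : ℚ_[p]} (ha : a ≠ 0) :
    lam (closedBall 0 ‖a‖) = ‖a‖ₑ * lam (closedBall 0 1) := by
  have hp : (0:ℝ) < p := by exact_mod_cast (Fact.out : p.Prime).pos
  rw [← ofReal_norm, Padic.norm_eq_zpow_neg_valuation ha, ball_zpow]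
  congr 1
  have hp' : (p : NNReal) ≠ 0 := by exact_mod_cast (Fact.out : p.Prime).ne_zero
  have h := ENNReal.coe_zpow hp' (-a.valuation)
  rw [ENNReal.coe_natCast] at h
  rw [← h, ← ENNReal.ofReal_coe_nnreal]
  congr 1

lemma map_mul {p : ℕ} [Fact p.Prime] [MeasurableSpace ℚ_[p]] [BorelSpace ℚ_[p]]
    (lam : Measure ℚ_[p]) [lam.IsAddHaarMeasure] {a : ℚ_[p]} (ha : a ≠ 0) :
    lam.map (fun x => a * x) = ‖a‖ₑ⁻¹ • lam := by
  let e : ℚ_[p] ≃+ ℚ_[p] := {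
    toFun := fun x => a * x
    invFun := fun x => a⁻¹ * x
    left_inv := fun x => by simp [ha]
    right_inv := fun x => by simp [ha]
    map_add' := fun x y => mul_add a x y }
  have hc : Continuous e := continuous_const_mul a
  have hc' : Continuous e.symm := continuous_const_mul a⁻¹
  have := e.isAddHaarMeasure_map lam hc hc'
  have h := Measure.isAddLeftInvariant_eq_smul (lam.map e) lam
  change lam.map e = _
  set c := (lam.map e).addHaarScalarFactor lam
  have h1 := congrArg (fun m => m (closedBall 0 ‖a‖)) h
  have hpos : 0 < ‖a‖ := norm_pos_iff.2 ha
  have hb0 : lam (closedBall 0 1) ≠ 0 := (measure_closedBall_pos lam 0 one_pos).ne'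
  have hbt : lam (closedBall 0 1) ≠ ⊤ := (isCompact_closedBall _ _).measure_lt_top.ne
  have he : e ⁻¹' (closedBall 0 ‖a‖) = closedBall 0 1 := by
    ext x
    simp only [Set.mem_preimage, mem_closedBall, dist_zero_right]
    change ‖a * x‖ ≤ _ ↔ _
    rw [norm_mul]
    exact ⟨fun h => by nlinarith, fun h => by nlinarith⟩
  simp only [Measure.map_apply hc.measurable isClosed_closedBall.measurableSet, he,
    Measure.smul_apply, ball_norm lam ha, ENNReal.smul_def, smul_eq_mul] at h1
  rw [← mul_assoc] at h1
  have h2 : (c : ENNReal) * ‖a‖ₑ = 1 := by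
    have h1' : 1 * lam (closedBall 0 1) = _ := (one_mul _).trans h1
    exact ((ENNReal.mul_left_inj hb0 hbt).1 h1').symm
  rw [h, ← ENNReal.eq_inv_of_mul_eq_one_left h2]
  rfl

lemma lint_mul {p : ℕ} [Fact p.Prime] [MeasurableSpace ℚ_[p]] [BorelSpace ℚ_[p]]
    (lam : Measure ℚ_[p]) [lam.IsAddHaarMeasure] {a : ℚ_[p]} (ha : a ≠ 0)
    {f : ℚ_[p] → ENNReal} (hf : Measurable f) :
    ∫⁻ x, f (a * x) ∂lam = ‖a‖ₑ⁻¹ * ∫⁻ x, f x ∂lam := by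
  rw [← smul_eq_mul, ← lintegral_smul_measure, ← map_mul lam ha,
    lintegral_map hf (measurable_const_mul a)]

lemma nu_mul {p : ℕ} [Fact p.Prime] [MeasurableSpace ℚ_[p]] [BorelSpace ℚ_[p]]
    (lam : Measure ℚ_[p]) [lam.IsAddHaarMeasure] {a : ℚ_[p]} (ha : a ≠ 0)
    {f : ℚ_[p] → ENNReal} (hf : Measurable f) :
    ∫⁻ x, ‖x‖ₑ⁻¹ * f (a * x) ∂lam = ∫⁻ x, ‖x‖ₑ⁻¹ * f x ∂lam := by
  have h := lint_mul lam ha (f := fun x => ‖x‖ₑ⁻¹ * f x) (by fun_prop)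
  have ha0 : ‖a‖ₑ ≠ 0 := by simpa using ha
  have hat : ‖a‖ₑ ≠ ⊤ := enorm_ne_top
  simp only [enorm_mul] at h
  have h2 : ∀ x, (‖a‖ₑ * ‖x‖ₑ)⁻¹ * f (a * x) = ‖a‖ₑ⁻¹ * (‖x‖ₑ⁻¹ * f (a * x)) := by
    intro x
    rw [ENNReal.mul_inv (Or.inl ha0) (Or.inl hat), mul_assoc]
  simp only [h2] at h
  rw [lintegral_const_mul _ (by fun_prop)] at h
  exact (ENNReal.mul_right_inj (by simpa using hat) (by simpa using ha)).1 h

lemma ae_ne {p : ℕ} [Fact p.Prime] [MeasurableSpace ℚ_[p]] [BorelSpace ℚ_[p]]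
    (lam : Measure ℚ_[p]) [lam.IsAddHaarMeasure] (c : ℚ_[p]) : ∀ᵐ x ∂lam, x ≠ c := by
  have : lam {c} = 0 := measure_singleton c
  exact measure_eq_zero_iff_ae_notMem.1 this

lemma nu_inv {p : ℕ} [Fact p.Prime] [MeasurableSpace ℚ_[p]] [BorelSpace ℚ_[p]]
    (lam : Measure ℚ_[p]) [lam.IsAddHaarMeasure]
    {f : ℚ_[p] → ENNReal} (hf : Measurable f) :
    ∫⁻ x, ‖x‖ₑ⁻¹ * f x⁻¹ ∂lam = ∫⁻ x, ‖x‖ₑ⁻¹ * f x ∂lam := by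
  let A : ℚ_[p] → ENNReal := (sphere (0:ℚ_[p]) 1).indicator 1
  have hA : Measurable A := measurable_one.indicator isClosed_sphere.measurableSet
  have hIA : ∫⁻ y, ‖y‖ₑ⁻¹ * A y ∂lam = lam (sphere 0 1) := by
    rw [← lintegral_indicator_one isClosed_sphere.measurableSet]
    congr 1
    ext y
    by_cases hy : y ∈ sphere (0:ℚ_[p]) 1
    · have : ‖y‖ₑ = 1 := by
        rw [← ofReal_norm, mem_sphere_zero_iff_norm.1 hy, ENNReal.ofReal_one]
      simp [A, this]
    · simp only [A, Set.indicator_of_notMem hy, mul_zero]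
  have h0 : lam (sphere 0 1) ≠ 0 := by
    have hs : ball (1:ℚ_[p]) 1 ⊆ sphere 0 1 := by
      intro x hx
      rw [mem_ball, dist_eq_norm] at hx
      rw [mem_sphere_zero_iff_norm]
      have := IsUltrametricDist.norm_add_eq_max_of_norm_ne_norm (x := x - 1) (y := 1)
        (by rw [norm_one]; exact hx.ne)
      rw [sub_add_cancel, norm_one, max_eq_right hx.le] at this
      exact this
    exact ((measure_ball_pos lam 1 one_pos).trans_le (measure_mono hs)).ne'
  have ht : lam (sphere 0 1) ≠ ⊤ := (isCompact_sphere _ _).measure_lt_top.ne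
  have key : (∫⁻ y, ‖y‖ₑ⁻¹ * A y ∂lam) * ∫⁻ x, ‖x‖ₑ⁻¹ * f x⁻¹ ∂lam
      = (∫⁻ y, ‖y‖ₑ⁻¹ * A y ∂lam) * ∫⁻ x, ‖x‖ₑ⁻¹ * f x ∂lam := by
    calc (∫⁻ y, ‖y‖ₑ⁻¹ * A y ∂lam) * ∫⁻ x, ‖x‖ₑ⁻¹ * f x⁻¹ ∂lam
        = ∫⁻ y, ‖y‖ₑ⁻¹ * A y * ∫⁻ x, ‖x‖ₑ⁻¹ * f x⁻¹ ∂lam ∂lam := by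
          rw [lintegral_mul_const _ (by fun_prop)]
      _ = ∫⁻ y, ‖y‖ₑ⁻¹ * A y * ∫⁻ x, ‖x‖ₑ⁻¹ * f (y * x⁻¹) ∂lam ∂lam := by
          apply lintegral_congr_ae
          filter_upwards [ae_ne lam 0] with y hy
          rw [← nu_mul lam (inv_ne_zero hy) (f := fun x => f x⁻¹) (by fun_prop)]
          simp only [mul_inv, inv_inv]
      _ = ∫⁻ y, ∫⁻ x, ‖x‖ₑ⁻¹ * (‖y‖ₑ⁻¹ * (A y * f (y * x⁻¹))) ∂lam ∂lam := by
          congr 1; ext y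
          rw [← lintegral_const_mul _ (by fun_prop)]
          congr 1; ext x; ring
      _ = ∫⁻ x, ∫⁻ y, ‖x‖ₑ⁻¹ * (‖y‖ₑ⁻¹ * (A y * f (y * x⁻¹))) ∂lam ∂lam := by
          apply lintegral_lintegral_swap
          apply Measurable.aemeasurable
          unfold Function.uncurry
          fun_prop
      _ = ∫⁻ x, ∫⁻ y, ‖x‖ₑ⁻¹ * (‖y‖ₑ⁻¹ * (A (x * y) * f y)) ∂lam ∂lam := by
          apply lintegral_congr_ae
          filter_upwards [ae_ne lam 0] with x hx
          rw [lintegral_const_mul _ (by fun_prop), lintegral_const_mul _ (by fun_prop)]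
          rw [← nu_mul lam hx (f := fun y => A y * f (y * x⁻¹)) (by fun_prop)]
          have : ∀ y, x * y * x⁻¹ = y := fun y => by field_simp
          simp only [this]
      _ = ∫⁻ y, ∫⁻ x, ‖x‖ₑ⁻¹ * (‖y‖ₑ⁻¹ * (A (x * y) * f y)) ∂lam ∂lam := by
          apply lintegral_lintegral_swap
          apply Measurable.aemeasurable
          unfold Function.uncurry
          fun_prop
      _ = ∫⁻ y, (∫⁻ x, ‖x‖ₑ⁻¹ * A x ∂lam) * (‖y‖ₑ⁻¹ * f y) ∂lam := by
          apply lintegral_congr_ae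
          filter_upwards [ae_ne lam 0] with y hy
          rw [← nu_mul lam hy hA, ← lintegral_mul_const _ (by fun_prop)]
          congr 1; ext x
          rw [mul_comm y x]; ring
      _ = _ := by rw [lintegral_const_mul _ (by fun_prop)]
  rw [hIA] at key
  exact (ENNReal.mul_right_inj h0 ht).1 key

lemma lint_inv {p : ℕ} [Fact p.Prime] [MeasurableSpace ℚ_[p]] [BorelSpace ℚ_[p]]
    (lam : Measure ℚ_[p]) [lam.IsAddHaarMeasure]
    {f : ℚ_[p] → ENNReal} (hf : Measurable f) :
    ∫⁻ x, (‖x‖ₑ⁻¹) ^ 2 * f x⁻¹ ∂lam = ∫⁻ x, f x ∂lam := by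
  have h := nu_inv lam (f := fun x => ‖x‖ₑ * f x) (by fun_prop)
  calc _ = ∫⁻ x, ‖x‖ₑ⁻¹ * (‖x⁻¹‖ₑ * f x⁻¹) ∂lam := by
        apply lintegral_congr_ae
        filter_upwards [ae_ne lam 0] with x hx
        rw [enorm_inv hx]; ring
    _ = _ := h
    _ = _ := by
        apply lintegral_congr_ae
        filter_upwards [ae_ne lam 0] with x hx
        rw [← mul_assoc, ENNReal.inv_mul_cancel (by simpa using hx) enorm_ne_top, one_mul]

end PadicSO2

theorem PadicSO2.haarMeasure_param_invariant {p : ℕ} [Fact p.Prime]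
    [MeasurableSpace ℚ_[p]] [BorelSpace ℚ_[p]]
    (κ : ℚ_[p]) (hκ : ¬ IsSquare (-κ))
    (lam : Measure ℚ_[p]) [lam.IsAddHaarMeasure] (β : ℚ_[p]) :
    Measure.map (fun α : ℚ_[p] => (α + β) / (1 - κ * α * β))
        (lam.withDensity fun α => ENNReal.ofReal ‖1 + κ * α ^ 2‖⁻¹)
      = lam.withDensity fun α => ENNReal.ofReal ‖1 + κ * α ^ 2‖⁻¹ := by
  have hne : ∀ α : ℚ_[p], 1 + κ * α ^ 2 ≠ 0 := by
    intro α h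
    have hα : α ≠ 0 := by rintro rfl; simp at h
    apply hκ
    refine ⟨α⁻¹, ?_⟩
    field_simp
    linear_combination -h
  have hκ0 : κ ≠ 0 := by rintro rfl; simp at hκ
  rcases eq_or_ne β 0 with rfl | hβ
  · simp
  have hD : ∀ α : ℚ_[p], ENNReal.ofReal ‖1 + κ * α ^ 2‖⁻¹ = ‖1 + κ * α ^ 2‖ₑ⁻¹ := by
    intro α
    rw [ENNReal.ofReal_inv_of_pos (norm_pos_iff.2 (hne α)), ofReal_norm]
  simp only [hD]
  have hT : Measurable (fun α : ℚ_[p] => (α + β) / (1 - κ * α * β)) := by fun_prop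
  refine Measure.ext_of_lintegral _ fun f hf => ?_
  rw [lintegral_map hf hT,
    lintegral_withDensity_eq_lintegral_mul _ (by fun_prop)
      (g := fun α => f ((α + β) / (1 - κ * α * β))) (hf.comp hT),
    lintegral_withDensity_eq_lintegral_mul _ (by fun_prop) hf]
  simp only [Pi.mul_apply]
  obtain ⟨b, hb⟩ : ∃ b, b = κ * β := ⟨_, rfl⟩
  have hb0 : b ≠ 0 := hb ▸ mul_ne_zero hκ0 hβ
  obtain ⟨E, hE⟩ : ∃ E, E = 1 + κ * β ^ 2 := ⟨_, rfl⟩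
  have hE0 : E ≠ 0 := hE ▸ hne β
  let H : ℚ_[p] → ENNReal := fun x => ‖1 + κ * x ^ 2‖ₑ⁻¹ * f x
  have hH : Measurable H := by fun_prop
  have hEe : ‖E‖ₑ ≠ 0 := by simpa using hE0
  have hbe : ‖b‖ₑ ≠ 0 := by simpa using hb0
  let G : ℚ_[p] → ENNReal := fun y => (‖y‖ₑ⁻¹) ^ 2 * (H (-b⁻¹ + E / b * y⁻¹))
  have hG : Measurable G := by fun_prop
  calc _ = ∫⁻ α, ‖E‖ₑ * G (1 + (-b) * α) ∂lam := by
        apply lintegral_congr_ae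
        filter_upwards [ae_ne lam b⁻¹] with α hα
        have hd : 1 + (-b) * α ≠ 0 := by
          intro h
          apply hα
          field_simp
          linear_combination -h
        have hTα : (α + β) / (1 - κ * α * β) = -b⁻¹ + E / b * (1 + (-b) * α)⁻¹ := by
          rw [show 1 - κ * α * β = 1 + (-b) * α by rw [hb]; ring]
          obtain ⟨d, hdd⟩ : ∃ d, d = 1 + (-b) * α := ⟨_, rfl⟩
          rw [← hdd] at hd ⊢
          field_simp
          rw [hdd, hE, hb]; ring
        simp only [G, H, ← hTα]
        have hid : 1 + κ * α ^ 2 = E⁻¹ * (1 + (-b) * α)^2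
            * (1 + κ * ((α + β) / (1 - κ * α * β)) ^ 2) := by
          rw [show 1 - κ * α * β = 1 + (-b) * α by rw [hb]; ring]
          obtain ⟨d, hdd⟩ : ∃ d, d = 1 + (-b) * α := ⟨_, rfl⟩
          rw [← hdd] at hd ⊢
          field_simp
          rw [hdd, hE, hb]; ring
        set t := (α + β) / (1 - κ * α * β)
        have hde : ‖1 + (-b) * α‖ₑ ≠ 0 := by simpa using hd
        rw [hid, enorm_mul, enorm_mul, enorm_inv hE0, enorm_pow,
          ENNReal.mul_inv (Or.inr enorm_ne_top) (Or.inr (by simpa using hne t)),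
          ENNReal.mul_inv (Or.inr (by simp)) (Or.inr (pow_ne_zero _ hde)),
          inv_inv, ENNReal.inv_pow]
        ring
    _ = ‖E‖ₑ * (‖b‖ₑ⁻¹ * ∫⁻ y, G y ∂lam) := by
        rw [lintegral_const_mul _ (by fun_prop),
          lint_mul lam (neg_ne_zero.2 hb0) (f := fun y => G (1 + y)) (by fun_prop),
          lintegral_add_left_eq_self G 1, enorm_neg]
    _ = ‖E‖ₑ * (‖b‖ₑ⁻¹ * (‖E / b‖ₑ⁻¹ * ∫⁻ y, H y ∂lam)) := by
        rw [lint_inv lam (f := fun y => H (-b⁻¹ + E / b * y)) (by fun_prop),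
          lint_mul lam (div_ne_zero hE0 hb0) (f := fun y => H (-b⁻¹ + y)) (by fun_prop),
          lintegral_add_left_eq_self H]
    _ = _ := by
        rw [div_eq_mul_inv, enorm_mul, enorm_inv hb0,
          ENNReal.mul_inv (Or.inl hEe) (Or.inl enorm_ne_top), inv_inv]
        calc _ = (‖E‖ₑ * ‖E‖ₑ⁻¹) * (‖b‖ₑ * ‖b‖ₑ⁻¹) * ∫⁻ y, H y ∂lam := by ring
          _ = _ := by
            rw [ENNReal.mul_inv_cancel hEe enorm_ne_top, ENNReal.mul_inv_cancel hbe enorm_ne_top,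
              one_mul, one_mul]
end

section
/- Let p be an odd prime and v ∈ ℚ_p a p-adic unit (|v|_p = 1) that is not a square in ℚ_p. In the quaternion algebra ℍ_p := ℍ[ℚ_p, v, −p] (with i² = v, j² = −p, k = i·j), define the reduced norm nrd(ξ) := q₀² − v·q₁² + p·q₂² − p·v·q₃² for ξ = q₀ + q₁·i + q₂·j + q₃·k. Then: (i) ξ · (star ξ) = nrd(ξ)·1 for every ξ ∈ ℍ_p; (ii) if ξ ≠ 0 then nrd(ξ) ≠ 0, ξ is a unit of ℍ_p, and ξ⁻¹ = nrd(ξ)⁻¹ · (star ξ). In particular ℍ_p is a division algebra over ℚ_p. -/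
open scoped Quaternion

/-- The reduced norm of a `p`-adic quaternion in `ℍ[ℚ_p, v, −p]`:
`nrd(ξ) = q₀² − v·q₁² + p·q₂² − p·v·q₃²`. -/
noncomputable def PadicQuat.nrd {p : ℕ} [Fact p.Prime] (v : ℚ_[p])
    (ξ : ℍ[ℚ_[p], v, -(p : ℚ_[p])]) : ℚ_[p] :=
  ξ.re ^ 2 - v * ξ.imI ^ 2 + (p : ℚ_[p]) * ξ.imJ ^ 2 - (p : ℚ_[p]) * v * ξ.imK ^ 2

theorem PadicQuat.isSquare_of_close {p : ℕ} [Fact p.Prime] (hp : p ≠ 2)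
    (v c : ℚ_[p]) (hv : ‖v‖ = 1) (hc : ‖c‖ = 1) (h : ‖c ^ 2 - v‖ < 1) : IsSquare v := by
  have h2 : ‖(2 : ℤ_[p])‖ = 1 := by
    have hcop : Nat.Coprime p 2 :=
      (Nat.coprime_primes (Fact.out : p.Prime) Nat.prime_two).2 hp
    have := (PadicInt.norm_natCast_eq_one_iff (p := p) (n := 2)).2 hcop
    exact_mod_cast this
  let v' : ℤ_[p] := ⟨v, hv.le⟩
  let c' : ℤ_[p] := ⟨c, hc.le⟩
  have hc' : ‖c'‖ = 1 := hc
  have h' : ‖c' ^ 2 - v'‖ < 1 := h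
  let F : Polynomial ℤ_[p] := Polynomial.X ^ 2 - Polynomial.C v'
  have hF : ∀ z, F.aeval z = z ^ 2 - v' := by intro z; simp [F]
  have hF' : F.derivative.aeval c' = 2 * c' := by simp [F, one_add_one_eq_two]
  obtain ⟨z, hz, -⟩ := hensels_lemma (F := F) (a := c') (by
    rw [hF, hF', norm_mul, h2, hc']; simpa using h')
  rw [hF] at hz
  refine ⟨(z : ℚ_[p]), ?_⟩
  have := congrArg (fun x : ℤ_[p] => (x : ℚ_[p])) (sub_eq_zero.1 hz)
  simp only [PadicInt.coe_pow] at this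
  rw [← sq, this]

theorem PadicQuat.norm_binary {p : ℕ} [Fact p.Prime] (hp : p ≠ 2)
    (v : ℚ_[p]) (hv : ‖v‖ = 1) (hv' : ¬ IsSquare v) (a b : ℚ_[p]) :
    ∃ m : ℚ_[p], ‖a ^ 2 - v * b ^ 2‖ = ‖m ^ 2‖ ∧ (m = 0 → a = 0 ∧ b = 0) := by
  have hvb : ‖v * b ^ 2‖ = ‖b‖ ^ 2 := by rw [norm_mul, hv, one_mul, norm_pow]
  by_cases hab : ‖a‖ = ‖b‖
  · refine ⟨b, ?_, fun h => ⟨norm_eq_zero.1 (by rw [hab, h, norm_zero]), h⟩⟩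
    by_cases hb : b = 0
    · have ha : a = 0 := norm_eq_zero.1 (by rw [hab, hb, norm_zero])
      simp [ha, hb]
    have hb' : ‖b‖ ≠ 0 := norm_ne_zero_iff.2 hb
    have hc : ‖a / b‖ = 1 := by rw [norm_div, hab, div_self hb']
    have e : a ^ 2 - v * b ^ 2 = ((a / b) ^ 2 - v) * b ^ 2 := by field_simp
    have hle : ‖(a / b) ^ 2 - v‖ ≤ 1 := by
      have := Padic.nonarchimedean ((a / b) ^ 2) (-v)
      rwa [norm_neg, norm_pow, hc, hv, one_pow, max_self, ← sub_eq_add_neg] at this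
    have h1 : ‖(a / b) ^ 2 - v‖ = 1 := by
      by_contra hne
      exact hv' (PadicQuat.isSquare_of_close hp v _ hv hc (lt_of_le_of_ne hle hne))
    rw [e, norm_mul, h1, one_mul]
  · have hne : ‖a ^ 2‖ ≠ ‖-(v * b ^ 2)‖ := by
      rw [norm_neg, hvb, norm_pow]
      intro h
      exact hab ((pow_left_inj₀ (norm_nonneg _) (norm_nonneg _) two_ne_zero).1 h)
    have key := IsUltrametricDist.norm_add_eq_max_of_norm_ne_norm hne
    rw [← sub_eq_add_neg, norm_neg, hvb, norm_pow] at key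
    rcases lt_or_gt_of_ne hab with hlt | hlt
    · refine ⟨b, ?_, fun h => ?_⟩
      · rw [key, norm_pow, max_eq_right (by gcongr)]
      · rw [h, norm_zero] at hlt
        exact absurd hlt (norm_nonneg _).not_gt
    · refine ⟨a, ?_, fun h => ?_⟩
      · rw [key, norm_pow, max_eq_left (by gcongr)]
      · rw [h, norm_zero] at hlt
        exact absurd hlt (norm_nonneg _).not_gt

theorem PadicQuat.aniso {p : ℕ} [Fact p.Prime] (hp : p ≠ 2)
    (v : ℚ_[p]) (hv : ‖v‖ = 1) (hv' : ¬ IsSquare v) (a b c d : ℚ_[p])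
    (h : a ^ 2 - v * b ^ 2 + (p : ℚ_[p]) * c ^ 2 - (p : ℚ_[p]) * v * d ^ 2 = 0) :
    a = 0 ∧ b = 0 ∧ c = 0 ∧ d = 0 := by
  obtain ⟨m, hm, hm0⟩ := PadicQuat.norm_binary hp v hv hv' a b
  obtain ⟨n, hn, hn0⟩ := PadicQuat.norm_binary hp v hv hv' c d
  have hp0 : (p : ℚ_[p]) ≠ 0 := by exact_mod_cast (Fact.out : p.Prime).ne_zero
  have e : a ^ 2 - v * b ^ 2 = -((p : ℚ_[p]) * (c ^ 2 - v * d ^ 2)) := by linear_combination h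
  have hmn : ‖m ^ 2‖ = ‖(p : ℚ_[p]) * n ^ 2‖ := by
    rw [← hm, e, norm_neg, norm_mul, hn, norm_mul]
  have hiff : m = 0 ↔ n = 0 := by
    have : ‖m ^ 2‖ = 0 ↔ ‖(p : ℚ_[p]) * n ^ 2‖ = 0 := by rw [hmn]
    rw [norm_eq_zero, norm_eq_zero] at this
    simpa [hp0] using this
  by_cases hmz : m = 0
  · obtain ⟨ha, hb⟩ := hm0 hmz
    obtain ⟨hc, hd⟩ := hn0 (hiff.1 hmz)
    exact ⟨ha, hb, hc, hd⟩
  · exfalso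
    have hnz : n ≠ 0 := fun h => hmz (hiff.2 h)
    have hn2 : n ^ 2 ≠ 0 := pow_ne_zero _ hnz
    rw [Padic.norm_eq_zpow_neg_valuation (pow_ne_zero _ hmz),
      Padic.norm_eq_zpow_neg_valuation (mul_ne_zero hp0 hn2)] at hmn
    have h1 : (1 : ℝ) < p := by exact_mod_cast (Fact.out : p.Prime).one_lt
    have := zpow_right_injective₀ (by linarith) h1.ne' hmn
    rw [Padic.valuation_mul hp0 hn2, Padic.valuation_p, Padic.valuation_pow,
      Padic.valuation_pow] at this
    push_cast at this
    omega

/-- For an odd prime `p` and `v` a non-square `p`-adic unit, in the quaternion algebra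
`ℍ_p = ℍ[ℚ_p, v, −p]`: (i) `ξ · star ξ = nrd(ξ)·1`; (ii) every nonzero `ξ` has nonzero
reduced norm, is a unit, and its inverse is `nrd(ξ)⁻¹ · star ξ`.
In particular `ℍ_p` is a division algebra over `ℚ_p`. -/
theorem PadicQuat.mul_star_and_inverse {p : ℕ} [Fact p.Prime] (hp : p ≠ 2)
    (v : ℚ_[p]) (hv : ‖v‖ = 1) (hv' : ¬ IsSquare v) :
    (∀ ξ : ℍ[ℚ_[p], v, -(p : ℚ_[p])],
        ξ * star ξ = (PadicQuat.nrd v ξ : ℍ[ℚ_[p], v, -(p : ℚ_[p])])) ∧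
    (∀ ξ : ℍ[ℚ_[p], v, -(p : ℚ_[p])], ξ ≠ 0 →
        PadicQuat.nrd v ξ ≠ 0 ∧ IsUnit ξ ∧
        ξ * ((PadicQuat.nrd v ξ)⁻¹ • star ξ) = 1 ∧
        ((PadicQuat.nrd v ξ)⁻¹ • star ξ) * ξ = 1) := by
  have h1 : ∀ ξ : ℍ[ℚ_[p], v, -(p : ℚ_[p])],
      ξ * star ξ = (PadicQuat.nrd v ξ : ℍ[ℚ_[p], v, -(p : ℚ_[p])]) := by
    intro ξ
    ext <;> simp <;> (try unfold PadicQuat.nrd) <;> ring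
  have h2 : ∀ ξ : ℍ[ℚ_[p], v, -(p : ℚ_[p])],
      star ξ * ξ = (PadicQuat.nrd v ξ : ℍ[ℚ_[p], v, -(p : ℚ_[p])]) := by
    intro ξ
    ext <;> simp <;> (try unfold PadicQuat.nrd) <;> ring
  refine ⟨h1, fun ξ hξ => ?_⟩
  have hn : PadicQuat.nrd v ξ ≠ 0 := by
    intro h
    obtain ⟨ha, hb, hc, hd⟩ := PadicQuat.aniso hp v hv hv' _ _ _ _ h
    exact hξ (by ext <;> simpa)
  have hl : ξ * ((PadicQuat.nrd v ξ)⁻¹ • star ξ) = 1 := by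
    rw [mul_smul_comm, h1, QuaternionAlgebra.smul_coe, inv_mul_cancel₀ hn,
      QuaternionAlgebra.coe_one]
  have hr : ((PadicQuat.nrd v ξ)⁻¹ • star ξ) * ξ = 1 := by
    rw [smul_mul_assoc, h2, QuaternionAlgebra.smul_coe, inv_mul_cancel₀ hn,
      QuaternionAlgebra.coe_one]
  exact ⟨hn, ⟨⟨ξ, _, hl, hr⟩, rfl⟩, hl, hr⟩
end

section
/- Let p be a prime and c₁, c₂ ∈ ℚ_p nonzero, and suppose the quaternion algebra H := ℍ[ℚ_p, c₁, c₂] is a division algebra (every nonzero element is a unit). Let nrd(ξ) := (ξ·star ξ).re. Then: (1) for all nonzero ξ, ρ ∈ H with nrd(ξ) = nrd(ρ), the map L_{ξ,ρ} : η ↦ ξ·η·ρ⁻¹ is a ℚ_p-linear automorphism of H satisfying nrd(L_{ξ,ρ}(η)) = nrd(η) for all η ∈ H and det L_{ξ,ρ} = 1; (2) conversely, every ℚ_p-linear endomorphism f of H with nrd(f(η)) = nrd(η) for all η ∈ H and det f = 1 equals L_{ξ,ρ} for some nonzero ξ, ρ with nrd(ξ) = nrd(ρ); (3) for two such pairs,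 L_{ξ,ρ} = L_{ξ',ρ'} if and only if there exists λ ∈ ℚ_p, λ ≠ 0, with ξ' = λ·ξ and ρ' = λ·ρ. In other words, (ξ,ρ) ↦ L_{ξ,ρ} is a surjective group homomorphism from the group P(H^×) := { (ξ,ρ) ∈ H^× × H^× | nrd(ξ) = nrd(ρ) } onto the special orthogonal group of the norm form of H, with kernel the diagonally embedded ℚ_p^×, so that this special orthogonal group is isomorphic to P(H^×)/ℚ_p^×. -/
open scoped Quaternion

/-- The reduced norm `nrd(ξ) = (ξ · star ξ).re` on a quaternion algebra. -/
def QuatAlg.nrd {R : Type*} [CommRing R] {c₁ c₂ : R} (ξ : ℍ[R, c₁, c₂]) : R :=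
  (ξ * star ξ).re

namespace QuatAlg

section helpers

variable {F : Type*} [Field F] {c₁ c₂ : F}

lemma nrd_eq (x : ℍ[F, c₁, c₂]) :
    nrd x = x.re ^ 2 - c₁ * x.imI ^ 2 - c₂ * x.imJ ^ 2 + c₁ * c₂ * x.imK ^ 2 := by
  simp [nrd]; ring

lemma nrd_mul (x y : ℍ[F, c₁, c₂]) : nrd (x * y) = nrd x * nrd y := by
  simp [nrd_eq]; ring

lemma nrd_one : nrd (1 : ℍ[F, c₁, c₂]) = 1 := by
  simp [nrd_eq]

lemma nrd_unit_mul_inv (u : ℍ[F, c₁, c₂]ˣ) :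
    nrd (u : ℍ[F, c₁, c₂]) * nrd (↑u⁻¹ : ℍ[F, c₁, c₂]) = 1 := by
  rw [← nrd_mul, Units.mul_inv, nrd_one]

lemma det_mulLeft (x : ℍ[F, c₁, c₂]) :
    LinearMap.det (LinearMap.mulLeft F x) = nrd x ^ 2 := by
  rw [← LinearMap.det_toMatrix (QuaternionAlgebra.basisOneIJK c₁ 0 c₂)]
  have : LinearMap.toMatrix (QuaternionAlgebra.basisOneIJK c₁ 0 c₂)
      (QuaternionAlgebra.basisOneIJK c₁ 0 c₂) (LinearMap.mulLeft F x) =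
      !![x.re, c₁ * x.imI, c₂ * x.imJ, -(c₁ * c₂ * x.imK);
         x.imI, x.re, c₂ * x.imK, -(c₂ * x.imJ);
         x.imJ, -(c₁ * x.imK), x.re, c₁ * x.imI;
         x.imK, -x.imJ, x.imI, x.re] := by
    ext i j
    rw [LinearMap.toMatrix_apply]
    fin_cases i <;> fin_cases j <;>
      simp [QuaternionAlgebra.basisOneIJK, Module.Basis.coe_ofEquivFun]
  rw [this, nrd_eq]
  simp [Matrix.det_succ_row_zero, Fin.sum_univ_succ, Fin.succAbove]
  ring

lemma det_mulRight (x : ℍ[F, c₁, c₂]) :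
    LinearMap.det (LinearMap.mulRight F x) = nrd x ^ 2 := by
  rw [← LinearMap.det_toMatrix (QuaternionAlgebra.basisOneIJK c₁ 0 c₂)]
  have : LinearMap.toMatrix (QuaternionAlgebra.basisOneIJK c₁ 0 c₂)
      (QuaternionAlgebra.basisOneIJK c₁ 0 c₂) (LinearMap.mulRight F x) =
      !![x.re, c₁ * x.imI, c₂ * x.imJ, -(c₁ * c₂ * x.imK);
         x.imI, x.re, -(c₂ * x.imK), (c₂ * x.imJ);
         x.imJ, (c₁ * x.imK), x.re, -(c₁ * x.imI);
         x.imK, x.imJ, -x.imI, x.re] := by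
    ext i j
    rw [LinearMap.toMatrix_apply]
    fin_cases i <;> fin_cases j <;>
      simp [QuaternionAlgebra.basisOneIJK, Module.Basis.coe_ofEquivFun]
  rw [this, nrd_eq]
  simp [Matrix.det_succ_row_zero, Fin.sum_univ_succ, Fin.succAbove]
  ring

/-- The map `η ↦ a η b`. -/
def lr (a b : ℍ[F, c₁, c₂]) : ℍ[F, c₁, c₂] →ₗ[F] ℍ[F, c₁, c₂] :=
  LinearMap.mulRight F b ∘ₗ LinearMap.mulLeft F a

lemma lr_apply (a b x : ℍ[F, c₁, c₂]) : lr a b x = a * x * b := rfl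

lemma det_lr (a b : ℍ[F, c₁, c₂]) : LinearMap.det (lr a b) = (nrd a * nrd b) ^ 2 := by
  rw [lr, LinearMap.det_comp, det_mulLeft, det_mulRight]; ring

/-- The reflection changing the sign of the last coordinate. -/
def refl : ℍ[F, c₁, c₂] →ₗ[F] ℍ[F, c₁, c₂] where
  toFun x := ⟨x.re, x.imI, x.imJ, -x.imK⟩
  map_add' x y := by ext <;> simp; ring
  map_smul' r x := by ext <;> simp

lemma refl_apply (x : ℍ[F, c₁, c₂]) : refl x = ⟨x.re, x.imI, x.imJ, -x.imK⟩ := rfl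

lemma det_refl : LinearMap.det (refl : ℍ[F, c₁, c₂] →ₗ[F] ℍ[F, c₁, c₂]) = -1 := by
  rw [← LinearMap.det_toMatrix (QuaternionAlgebra.basisOneIJK c₁ 0 c₂)]
  have : LinearMap.toMatrix (QuaternionAlgebra.basisOneIJK c₁ 0 c₂)
      (QuaternionAlgebra.basisOneIJK c₁ 0 c₂) refl =
      !![1, 0, 0, 0; 0, 1, 0, 0; 0, 0, 1, 0; 0, 0, 0, -1] := by
    ext i j
    rw [LinearMap.toMatrix_apply]
    fin_cases i <;> fin_cases j <;>
      simp [QuaternionAlgebra.basisOneIJK, Module.Basis.coe_ofEquivFun, refl_apply]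
  rw [this]
  simp [Matrix.det_succ_row_zero, Fin.sum_univ_succ, Fin.succAbove]

/-- The basis element `i`. -/
def qi : ℍ[F, c₁, c₂] := ⟨0, 1, 0, 0⟩
/-- The basis element `j`. -/
def qj : ℍ[F, c₁, c₂] := ⟨0, 0, 1, 0⟩
/-- The basis element `k`. -/
def qk : ℍ[F, c₁, c₂] := ⟨0, 0, 0, 1⟩

lemma qi_mul_qi : (qi * qi : ℍ[F, c₁, c₂]) = algebraMap F _ c₁ := by
  ext <;> simp [qi]
lemma qj_mul_qj : (qj * qj : ℍ[F, c₁, c₂]) = algebraMap F _ c₂ := by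
  ext <;> simp [qj]
lemma qi_mul_qj : (qi * qj : ℍ[F, c₁, c₂]) = qk := by
  ext <;> simp [qi, qj, qk]
lemma qj_mul_qi : (qj * qi : ℍ[F, c₁, c₂]) = -(qi * qj) := by
  ext <;> simp [qi, qj]

lemma decomp (x : ℍ[F, c₁, c₂]) :
    x = x.re • 1 + x.imI • qi + x.imJ • qj + x.imK • qk := by
  ext <;> simp [qi, qj, qk]

/-- Averaging operator intertwining two pairs of anticommuting square roots. -/
def av {A : Type*} [Ring A] [Algebra F A] (c₁ c₂ : F) (i j I J x : A) : A :=
  (c₁ * c₂) • x + c₂ • (I * x * i) + c₁ • (J * x * j) - I * J * x * (i * j)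

lemma av_i {A : Type*} [Ring A] [Algebra F A] (c₁ c₂ : F) (i j I J x : A)
    (hi : i * i = algebraMap F A c₁) (hji : j * i = -(i * j))
    (hI : I * I = algebraMap F A c₁) :
    av c₁ c₂ i j I J x * i = I * av c₁ c₂ i j I J x := by
  have e1 : I * x * i * i = c₁ • (I * x) := by
    rw [mul_assoc, hi, Algebra.smul_def, Algebra.commutes]
  have e2 : J * x * j * i = -(J * x * (i * j)) := by
    rw [mul_assoc, hji, mul_neg]
  have e3 : I * J * x * (i * j) * i = - (c₁ • (I * J * x * j)) := by
    rw [mul_assoc, mul_assoc i, hji, mul_neg, mul_neg, ← mul_assoc i, hi, ← Algebra.smul_def,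
      mul_smul_comm]
  have f1 : I * (I * x * i) = c₁ • (x * i) := by
    rw [mul_assoc I x, ← mul_assoc I I, hI, Algebra.smul_def]
  have f2 : I * (J * x * j) = I * J * x * j := by simp only [mul_assoc]
  have f3 : I * (I * J * x * (i * j)) = c₁ • (J * x * (i * j)) := by
    rw [show I * (I * J * x * (i * j)) = I * I * (J * x * (i * j)) by simp only [mul_assoc], hI,
      Algebra.smul_def]
  simp only [av, add_mul, sub_mul, mul_add, mul_sub, smul_mul_assoc, mul_smul_comm,
    e1, e2, e3, f1, f2, f3]
  module

lemma av_j {A : Type*} [Ring A] [Algebra F A] (c₁ c₂ : F) (i j I J x : A)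
    (hj : j * j = algebraMap F A c₂) (hji : j * i = -(i * j))
    (hJ : J * J = algebraMap F A c₂) (hJI : J * I = -(I * J)) :
    av c₁ c₂ i j I J x * j = J * av c₁ c₂ i j I J x := by
  have e1 : J * x * j * j = c₂ • (J * x) := by
    rw [mul_assoc, hj, Algebra.smul_def, Algebra.commutes]
  have e2 : I * x * i * j = (I * x * (i * j)) := by
    rw [mul_assoc]
  have e3 : I * J * x * (i * j) * j = (c₂ • (I * J * x * i)) := by
    rw [mul_assoc, mul_assoc i, hj, ← Algebra.commutes, ← Algebra.smul_def,
      mul_smul_comm]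
  have f1 : J * (J * x * j) = c₂ • (x * j) := by
    rw [mul_assoc J x, ← mul_assoc J J, hJ, Algebra.smul_def]
  have f2 : J * (I * x * i) = -(I * J * x * i) := by
    rw [show J * (I * x * i) = (J * I) * x * i by simp only [mul_assoc], hJI]
    simp only [neg_mul]
  have f3 : J * (I * J * x * (i * j)) = -(c₂ • (I * x * (i * j))) := by
    rw [show J * (I * J * x * (i * j)) = J * I * J * x * (i * j) by simp only [mul_assoc], hJI,
      neg_mul, mul_assoc I, hJ, ← Algebra.commutes, ← Algebra.smul_def]
    simp only [neg_mul, smul_mul_assoc]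
  simp only [av, add_mul, sub_mul, mul_add, mul_sub, smul_mul_assoc, mul_smul_comm,
    e1, e2, e3, f1, f2, f3]
  module

lemma av_sum (I J : ℍ[F, c₁, c₂]) :
    (c₁ * c₂) • av c₁ c₂ qi qj I J 1 + c₂ • (av c₁ c₂ qi qj I J qi * qi)
      + c₁ • (av c₁ c₂ qi qj I J qj * qj) - av c₁ c₂ qi qj I J qk * qk =
      (4 * (c₁ * c₂) ^ 2) • 1 := by
  generalize hM : I * J = M
  ext <;> simp [av, qi, qj, qk, hM] <;> ring

lemma skolem [CharZero F] (hc₁ : c₁ ≠ 0) (hc₂ : c₂ ≠ 0)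
    (hdiv : ∀ ξ : ℍ[F, c₁, c₂], ξ ≠ 0 → IsUnit ξ) (I J : ℍ[F, c₁, c₂])
    (hI : I * I = algebraMap F _ c₁) (hJ : J * J = algebraMap F _ c₂)
    (hJI : J * I = -(I * J)) :
    ∃ u : ℍ[F, c₁, c₂]ˣ, (u : ℍ[F, c₁, c₂]) * qi = I * (u : ℍ[F, c₁, c₂]) ∧ (u : ℍ[F, c₁, c₂]) * qj = J * (u : ℍ[F, c₁, c₂]) := by
  have : ∃ x : ℍ[F, c₁, c₂], av c₁ c₂ qi qj I J x ≠ 0 := by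
    by_contra! h
    have := av_sum I J
    simp only [h] at this
    have h1 := congrArg QuaternionAlgebra.re this
    simp [hc₁, hc₂] at h1
  obtain ⟨x, hx⟩ := this
  obtain ⟨u, hu⟩ := hdiv _ hx
  refine ⟨u, ?_, ?_⟩
  · rw [hu]; exact av_i _ _ _ _ _ _ _ qi_mul_qi qj_mul_qi hI
  · rw [hu]; exact av_j _ _ _ _ _ _ _ qj_mul_qj qj_mul_qi hJ hJI

lemma anti (x y : ℍ[F, c₁, c₂]) (hx : x.re = 0) (hy : y.re = 0) :
    x * y + y * x = algebraMap F _ (nrd x + nrd y - nrd (x + y)) := by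
  rw [QuaternionAlgebra.algebraMap_eq]
  ext <;> simp [nrd_eq, hx, hy] <;> ring

lemma pure_sq (x : ℍ[F, c₁, c₂]) (hx : x.re = 0) :
    x * x = algebraMap F _ (- nrd x) := by
  rw [QuaternionAlgebra.algebraMap_eq]
  ext <;> simp [nrd_eq, hx] <;> ring

lemma nrd_one_add (x : ℍ[F, c₁, c₂]) : nrd (1 + x) = 1 + 2 * x.re + nrd x := by
  simp [nrd_eq]; ring

lemma scalar_of_comm [CharZero F] (hc₁ : c₁ ≠ 0) (hc₂ : c₂ ≠ 0) (v : ℍ[F, c₁, c₂])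
    (h : ∀ x, v * x = x * v) : v = algebraMap F _ v.re := by
  have h1 := h qi
  have h2 := h qj
  have e1 := congrArg QuaternionAlgebra.imJ h1
  have e2 := congrArg QuaternionAlgebra.imK h1
  have e3 := congrArg QuaternionAlgebra.imK h2
  simp [qi, qj, hc₁, hc₂, self_eq_neg, neg_eq_self] at e1 e2 e3
  ext <;> simp [e1, e2, e3]

/-- The third anticommuting element is determined up to sign. -/
lemma third [CharZero F] (hc₁ : c₁ ≠ 0) (hc₂ : c₂ ≠ 0) (I J K : ℍ[F, c₁, c₂])
    (hI0 : I.re = 0) (hJ0 : J.re = 0) (hK0 : K.re = 0)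
    (hI : I * I = algebraMap F _ c₁) (hJ : J * J = algebraMap F _ c₂)
    (hK : K * K = algebraMap F _ (-(c₁ * c₂)))
    (hJI : J * I = -(I * J)) (hKI : K * I = -(I * K)) (hKJ : K * J = -(J * K)) :
    K = I * J ∨ K = -(I * J) := by
  have hcomm : K * (I * J) = (I * J) * K := by
    rw [← mul_assoc, hKI, neg_mul, mul_assoc, hKJ, mul_neg, neg_neg, mul_assoc]
  have hs : ∀ x : ℍ[F, c₁, c₂], x.re = 0 → star x = -x := fun x hx => by
    ext <;> simp [hx]
  have hz : star (K * (I * J)) = K * (I * J) := by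
    rw [star_mul, star_mul, hs _ hI0, hs _ hJ0, hs _ hK0, neg_mul_neg, hJI, neg_mul_neg, hcomm]
  rw [QuaternionAlgebra.star_eq_self] at hz
  have hM : (I * J) * (I * J) = algebraMap F _ (-(c₁ * c₂)) := by
    rw [mul_assoc, ← mul_assoc J, hJI, neg_mul, mul_neg, mul_assoc, hJ, ← mul_assoc, hI, map_neg,
      map_mul]
  set t := (K * (I * J)).re with ht
  have h2 : algebraMap F ℍ[F, c₁, c₂] (t * t) = algebraMap F _ ((c₁ * c₂) * (c₁ * c₂)) := by
    rw [map_mul]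
    change (t : ℍ[F, c₁, c₂]) * (t : ℍ[F, c₁, c₂]) = _
    rw [← hz]
    nth_rewrite 2 [hcomm]
    rw [show K * (I * J) * (I * J * K) = K * ((I * J) * (I * J)) * K by simp only [mul_assoc],
      hM, ← Algebra.commutes, mul_assoc, hK, ← map_mul, neg_mul_neg]
  have h3 := QuaternionAlgebra.algebraMap_injective h2
  have h4 : (-(c₁ * c₂)) • K = t • (I * J) := by
    rw [Algebra.smul_def, Algebra.commutes, ← hM, ← mul_assoc, hz, QuaternionAlgebra.coe_mul_eq_smul]
  have hne : -(c₁ * c₂) ≠ 0 := by simp [hc₁, hc₂]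
  rcases mul_self_eq_mul_self_iff.1 h3 with h | h
  · right
    apply smul_right_injective _ hne
    simp only [h4, h]; module
  · left
    apply smul_right_injective _ hne
    simp only [h4, h]

lemma key [CharZero F] (hc₁ : c₁ ≠ 0) (hc₂ : c₂ ≠ 0)
    (hdiv : ∀ ξ : ℍ[F, c₁, c₂], ξ ≠ 0 → IsUnit ξ)
    (g : ℍ[F, c₁, c₂] →ₗ[F] ℍ[F, c₁, c₂]) (hg : ∀ x, nrd (g x) = nrd x) (h1 : g 1 = 1)
    (hdet : LinearMap.det g = 1) :
    ∃ u : ℍ[F, c₁, c₂]ˣ, ∀ x, g x = u * x * (↑u⁻¹ : ℍ[F, c₁, c₂]) := by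
  have hp : ∀ x, x.re = 0 → (g x).re = 0 := fun x hx => by
    have e := hg (1 + x)
    rw [map_add, h1, nrd_one_add, nrd_one_add, hg, hx] at e
    simpa using e
  have han : ∀ x y, x.re = 0 → y.re = 0 → x * y = -(y * x) → g x * g y = -(g y * g x) := by
    intro x y hx hy h
    have e1 := anti x y hx hy
    have e2 := anti (g x) (g y) (hp x hx) (hp y hy)
    rw [← map_add g, hg, hg, hg, ← e1, h, neg_add_cancel] at e2
    exact eq_neg_of_add_eq_zero_left e2
  have hsq : ∀ x, x.re = 0 → g x * g x = x * x := fun x hx => by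
    rw [pure_sq _ (hp x hx), pure_sq x hx, hg]
  have hi0 : (qi : ℍ[F, c₁, c₂]).re = 0 := rfl
  have hj0 : (qj : ℍ[F, c₁, c₂]).re = 0 := rfl
  have hk0 : (qk : ℍ[F, c₁, c₂]).re = 0 := rfl
  have hI := (hsq qi hi0).trans qi_mul_qi
  have hJ := (hsq qj hj0).trans qj_mul_qj
  have hK : g qk * g qk = algebraMap F _ (-(c₁ * c₂)) :=
    (hsq qk hk0).trans (by ext <;> simp [qk])
  have hJI := han qj qi hj0 hi0 qj_mul_qi
  have hKI := han qk qi hk0 hi0 (by ext <;> simp [qk, qi])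
  have hKJ := han qk qj hk0 hj0 (by ext <;> simp [qk, qj])
  obtain ⟨u, hu1, hu2⟩ := skolem hc₁ hc₂ hdiv _ _ hI hJ hJI
  have hu1' : g qi = (u : ℍ[F, c₁, c₂]) * qi * (↑u⁻¹ : ℍ[F, c₁, c₂]) := by
    rw [hu1, Units.mul_inv_cancel_right]
  have hu2' : g qj = (u : ℍ[F, c₁, c₂]) * qj * (↑u⁻¹ : ℍ[F, c₁, c₂]) := by
    rw [hu2, Units.mul_inv_cancel_right]
  have hu3 : g qi * g qj = (u : ℍ[F, c₁, c₂]) * qk * (↑u⁻¹ : ℍ[F, c₁, c₂]) := by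
    rw [hu1', hu2', ← qi_mul_qj]
    simp only [mul_assoc, Units.inv_mul_cancel_left]
  refine ⟨u, ?_⟩
  rcases third hc₁ hc₂ _ _ _ (hp _ hi0) (hp _ hj0) (hp _ hk0) hI hJ hK hJI hKI hKJ with h | h
  · rw [hu3] at h
    intro x
    rw [decomp x]
    simp only [map_add, map_smul, h1, h, hu1', hu2', mul_add, add_mul, mul_smul_comm,
      smul_mul_assoc, mul_one, Units.mul_inv]
  · exfalso
    rw [hu3] at h
    have hgl : g = lr (u : ℍ[F, c₁, c₂]) (↑u⁻¹ : ℍ[F, c₁, c₂]) ∘ₗ refl := by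
      ext1 x
      rw [LinearMap.comp_apply, lr_apply,
        show refl x = x.re • 1 + x.imI • qi + x.imJ • qj - x.imK • qk by
          ext <;> simp [qi, qj, qk, refl_apply]]
      conv_lhs => rw [decomp x]
      simp only [map_add, map_smul, h1, h, hu1', hu2', mul_add, add_mul, mul_smul_comm,
        smul_mul_assoc, mul_one, Units.mul_inv, mul_neg, neg_mul, smul_neg, sub_eq_add_neg]
    rw [hgl, LinearMap.det_comp, det_lr, nrd_unit_mul_inv, det_refl] at hdet
    norm_num at hdet

end helpers

end QuatAlg

/-- For a `p`-adic quaternion division algebra `H = ℍ[ℚ_p, c₁, c₂]`, the two-sided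
multiplication maps `L_{ξ,ρ} : η ↦ ξ·η·ρ⁻¹`, for pairs of units with equal reduced norm,
realize the special orthogonal group of the norm form of `H` as
`P(H^×)/ℚ_p^×`: (1) each `L_{ξ,ρ}` is a norm-preserving linear automorphism of
determinant one; (2) every norm-preserving determinant-one linear endomorphism of `H`
is of this form; (3) `L_{ξ,ρ} = L_{ξ',ρ'}` iff `(ξ',ρ') = (λξ, λρ)` for some nonzero
scalar `λ`. -/
theorem QuatAlg.pairs_SO4 {p : ℕ} [Fact p.Prime] (c₁ c₂ : ℚ_[p])
    (hc₁ : c₁ ≠ 0) (hc₂ : c₂ ≠ 0)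
    (hdiv : ∀ ξ : ℍ[ℚ_[p], c₁, c₂], ξ ≠ 0 → IsUnit ξ) :
    (∀ ξ ρ : ℍ[ℚ_[p], c₁, c₂]ˣ,
        QuatAlg.nrd (ξ : ℍ[ℚ_[p], c₁, c₂]) = QuatAlg.nrd (ρ : ℍ[ℚ_[p], c₁, c₂]) →
        ∃ f : ℍ[ℚ_[p], c₁, c₂] →ₗ[ℚ_[p]] ℍ[ℚ_[p], c₁, c₂],
          (∀ η : ℍ[ℚ_[p], c₁, c₂],
            f η = (ξ : ℍ[ℚ_[p], c₁, c₂]) * η * (↑ρ⁻¹ : ℍ[ℚ_[p], c₁, c₂])) ∧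
          Function.Bijective f ∧
          (∀ η : ℍ[ℚ_[p], c₁, c₂], QuatAlg.nrd (f η) = QuatAlg.nrd η) ∧
          LinearMap.det f = 1) ∧
    (∀ f : ℍ[ℚ_[p], c₁, c₂] →ₗ[ℚ_[p]] ℍ[ℚ_[p], c₁, c₂],
        (∀ η : ℍ[ℚ_[p], c₁, c₂], QuatAlg.nrd (f η) = QuatAlg.nrd η) →
        LinearMap.det f = 1 →
        ∃ ξ ρ : ℍ[ℚ_[p], c₁, c₂]ˣ,
          QuatAlg.nrd (ξ : ℍ[ℚ_[p], c₁, c₂]) = QuatAlg.nrd (ρ : ℍ[ℚ_[p], c₁, c₂]) ∧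
          ∀ η : ℍ[ℚ_[p], c₁, c₂],
            f η = (ξ : ℍ[ℚ_[p], c₁, c₂]) * η * (↑ρ⁻¹ : ℍ[ℚ_[p], c₁, c₂])) ∧
    (∀ ξ ρ ξ' ρ' : ℍ[ℚ_[p], c₁, c₂]ˣ,
        QuatAlg.nrd (ξ : ℍ[ℚ_[p], c₁, c₂]) = QuatAlg.nrd (ρ : ℍ[ℚ_[p], c₁, c₂]) →
        QuatAlg.nrd (ξ' : ℍ[ℚ_[p], c₁, c₂]) = QuatAlg.nrd (ρ' : ℍ[ℚ_[p], c₁, c₂]) →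
        ((∀ η : ℍ[ℚ_[p], c₁, c₂],
            (ξ : ℍ[ℚ_[p], c₁, c₂]) * η * (↑ρ⁻¹ : ℍ[ℚ_[p], c₁, c₂])
              = (ξ' : ℍ[ℚ_[p], c₁, c₂]) * η * (↑ρ'⁻¹ : ℍ[ℚ_[p], c₁, c₂])) ↔
          ∃ lam : ℚ_[p], lam ≠ 0 ∧
            (ξ' : ℍ[ℚ_[p], c₁, c₂]) = lam • (ξ : ℍ[ℚ_[p], c₁, c₂]) ∧
            (ρ' : ℍ[ℚ_[p], c₁, c₂]) = lam • (ρ : ℍ[ℚ_[p], c₁, c₂]))) := by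
  refine ⟨?_, ?_, ?_⟩
  · intro ξ ρ h
    refine ⟨QuatAlg.lr (ξ : ℍ[ℚ_[p], c₁, c₂]) (↑ρ⁻¹ : ℍ[ℚ_[p], c₁, c₂]), fun η => rfl, ?_, ?_, ?_⟩
    · refine Function.bijective_iff_has_inverse.2
        ⟨fun η => (↑ξ⁻¹ : ℍ[ℚ_[p], c₁, c₂]) * η * (ρ : ℍ[ℚ_[p], c₁, c₂]), fun η => ?_, fun η => ?_⟩
      · simp [QuatAlg.lr_apply, mul_assoc]
      · simp [QuatAlg.lr_apply, mul_assoc]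
    · intro η
      have := QuatAlg.nrd_unit_mul_inv ρ
      rw [QuatAlg.lr_apply, QuatAlg.nrd_mul, QuatAlg.nrd_mul, h]
      linear_combination QuatAlg.nrd η * this
    · rw [QuatAlg.det_lr, h, QuatAlg.nrd_unit_mul_inv, one_pow]
  · intro f hf hdet
    have ha : QuatAlg.nrd (f 1) = 1 := by rw [hf, QuatAlg.nrd_one]
    have ha0 : f 1 ≠ 0 := by
      intro h
      rw [h] at ha
      simp [QuatAlg.nrd_eq] at ha
    obtain ⟨a, haa⟩ := hdiv _ ha0
    have ha' : QuatAlg.nrd (↑a⁻¹ : ℍ[ℚ_[p], c₁, c₂]) = 1 := by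
      have := QuatAlg.nrd_unit_mul_inv a
      rwa [haa, ha, one_mul] at this
    obtain ⟨u, hu⟩ := QuatAlg.key hc₁ hc₂ hdiv
      (LinearMap.mulLeft ℚ_[p] (↑a⁻¹ : ℍ[ℚ_[p], c₁, c₂]) ∘ₗ f)
      (fun x => by
        rw [LinearMap.comp_apply, LinearMap.mulLeft_apply, QuatAlg.nrd_mul, ha', hf, one_mul])
      (by rw [LinearMap.comp_apply, LinearMap.mulLeft_apply, ← haa, Units.inv_mul])
      (by rw [LinearMap.det_comp, QuatAlg.det_mulLeft, ha', hdet]; norm_num)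
    refine ⟨a * u, u, ?_, fun η => ?_⟩
    · rw [Units.val_mul, QuatAlg.nrd_mul, haa, ha, one_mul]
    · have := hu η
      rw [LinearMap.comp_apply, LinearMap.mulLeft_apply, Units.inv_mul_eq_iff_eq_mul] at this
      rw [this, Units.val_mul]
      simp only [mul_assoc]
  · intro ξ ρ ξ' ρ' _ _
    constructor
    · intro h
      have h2 : ∀ η : ℍ[ℚ_[p], c₁, c₂], (↑(ξ'⁻¹ * ξ) : ℍ[ℚ_[p], c₁, c₂]) * η =
          η * (↑(ρ'⁻¹ * ρ) : ℍ[ℚ_[p], c₁, c₂]) := by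
        intro η
        have := congrArg (fun z => (↑ξ'⁻¹ : ℍ[ℚ_[p], c₁, c₂]) * z * (ρ : ℍ[ℚ_[p], c₁, c₂])) (h η)
        simpa [mul_assoc] using this
      have h1 := h2 1
      rw [mul_one, one_mul] at h1
      have hs := QuatAlg.scalar_of_comm hc₁ hc₂ (↑(ξ'⁻¹ * ξ) : ℍ[ℚ_[p], c₁, c₂])
        (fun x => by rw [h2 x, h1])
      set m := (↑(ξ'⁻¹ * ξ) : ℍ[ℚ_[p], c₁, c₂]).re
      have hm : m ≠ 0 := by
        intro h0
        rw [h0, map_zero] at hs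
        exact (ξ'⁻¹ * ξ).ne_zero hs
      have a1 : (ξ : ℍ[ℚ_[p], c₁, c₂]) = m • (ξ' : ℍ[ℚ_[p], c₁, c₂]) := by
        rw [Algebra.smul_def, Algebra.commutes, ← hs, ← Units.val_mul, mul_inv_cancel_left]
      have a2 : (ρ : ℍ[ℚ_[p], c₁, c₂]) = m • (ρ' : ℍ[ℚ_[p], c₁, c₂]) := by
        rw [Algebra.smul_def, Algebra.commutes, ← hs, h1, ← Units.val_mul, mul_inv_cancel_left]
      refine ⟨m⁻¹, inv_ne_zero hm, ?_, ?_⟩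
      · rw [a1, inv_smul_smul₀ hm]
      · rw [a2, inv_smul_smul₀ hm]
    · rintro ⟨l, hl, h1, h2⟩ η
      have h3 : (↑ρ'⁻¹ : ℍ[ℚ_[p], c₁, c₂]) = l⁻¹ • (↑ρ⁻¹ : ℍ[ℚ_[p], c₁, c₂]) := by
        rw [Units.inv_eq_of_mul_eq_one_right]
        rw [h2, smul_mul_smul_comm, mul_inv_cancel₀ hl, Units.mul_inv, one_smul]
      rw [h1, h3, smul_mul_assoc, smul_mul_smul_comm, mul_inv_cancel₀ hl, one_smul]
end
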